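/- For every integer m ≥ 1 and all reals θ > 0 and a > −1 such that k + 1 + 1/θ − m is not a nonpositive integer for any k ∈ {0,…,m−1} (this holds, e.g., whenever 1/θ is not an integer), the average von Neumann entropy over the quantum interpolating ensemble is E_f[−Σ_{i=1}^m λ_i ln λ_i] = ψ₀(d+1) − Σ_{k=0}^{m−1} (−1)^{k+m−1} (θk+a+3/2) B_θ(k) / (d (m−1−k)! k!), where B_θ(k) = [Γ(k+(2a+3)/θ) Γ(k+m+(2a+2)/θ) Γ(k+1+1/θ)] / [Γ(k+(2a+2)/θ) Γ(k+m+(2a+3)/θ) Γ(k+1+1/θ−m)] × ( ψ₀(k+(2a+3)/θ) + ψ₀(k+1+1/θ) − ψ₀(k+m+(2a+3)/θ) − ψ₀(k+1+1/θ−m) + θ( ψ₀(θk+a+2) − (θk+a+1)/(θk+a+3/2) ) ). -/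

import Mathlib

open Finset MeasureTheory Set

noncomputable section

/-- The unconstrained interpolating weight on `[0,∞)^m`:
`h̃(x) = ∏_{i<j} ((x_i−x_j)/(x_i+x_j))·(x_i^θ−x_j^θ) · ∏_i x_i^a e^{−x_i}`. -/
def hWeight (m : ℕ) (θ a : ℝ) (x : Fin m → ℝ) : ℝ :=
  (∏ p ∈ Finset.univ.filter (fun p : Fin m × Fin m => p.1 < p.2),
      ((x p.1 - x p.2) / (x p.1 + x p.2) * (x p.1 ^ θ - x p.2 ^ θ)))
    * ∏ i, x i ^ a * Real.exp (-(x i))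

/-- The positive orthant `[0,∞)^m`. -/
def orthant (m : ℕ) : Set (Fin m → ℝ) := {x | ∀ i, 0 ≤ x i}

/-- The unconstrained average
`E_h[G] = (∫_{[0,∞)^m} G h̃)/(∫_{[0,∞)^m} h̃)`. -/
def Eh (m : ℕ) (θ a : ℝ) (G : (Fin m → ℝ) → ℝ) : ℝ :=
  (∫ x in orthant m, G x * hWeight m θ a x) / (∫ x in orthant m, hWeight m θ a x)

/-- The density (up to normalization) of the quantum interpolating ensemble:
`Ṽ(λ) = ∏_{i<j} ((λ_i−λ_j)/(λ_i+λ_j))·(λ_i^θ−λ_j^θ) · ∏_i λ_i^a`. -/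
def Vdens (m : ℕ) (θ a : ℝ) (lam : Fin m → ℝ) : ℝ :=
  (∏ p ∈ Finset.univ.filter (fun p : Fin m × Fin m => p.1 < p.2),
      ((lam p.1 - lam p.2) / (lam p.1 + lam p.2) * (lam p.1 ^ θ - lam p.2 ^ θ)))
    * ∏ i, lam i ^ a

/-- Parametrization of the probability simplex: the first `m−1` coordinates
are free and the last one is `1 −` their sum. -/
def simplexExt (m : ℕ) (lam : Fin (m - 1) → ℝ) : Fin m → ℝ :=
  fun i => if h : (i : ℕ) < m - 1 then lam ⟨i, h⟩ else 1 - ∑ j, lam j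

/-- The parameter domain `Δ = {λ ∈ [0,∞)^{m−1} : Σ λ_i ≤ 1}` of the simplex. -/
def simplexDom (m : ℕ) : Set (Fin (m - 1) → ℝ) :=
  {lam | (∀ i, 0 ≤ lam i) ∧ ∑ i, lam i ≤ 1}

/-- The constrained average over the quantum interpolating ensemble:
`E_f[G] = (∫_Δ G(λ) Ṽ(λ) dλ)/(∫_Δ Ṽ(λ) dλ)`, where `λ` runs over the simplex
parametrized by its first `m−1` coordinates. -/
def Ef (m : ℕ) (θ a : ℝ) (G : (Fin m → ℝ) → ℝ) : ℝ :=
  (∫ l in simplexDom m, G (simplexExt m l) * Vdens m θ a (simplexExt m l))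
    / (∫ l in simplexDom m, Vdens m θ a (simplexExt m l))

/-- The parameter `d = m(mθ − θ + 2a + 2)/2`. -/
def dPar (m : ℕ) (θ a : ℝ) : ℝ := m * (m * θ - θ + 2 * a + 2) / 2

/-- The digamma function `ψ₀ = Γ'/Γ`. -/
def psi0 (x : ℝ) : ℝ := deriv Real.Gamma x / Real.Gamma x

/-- The Schur product `∏_{i<j} (x_i−x_j)/(x_i+x_j)`. -/
def schurProd {n : ℕ} (x : Fin n → ℝ) : ℝ :=
  ∏ i, ∏ j ∈ Finset.Ioi i, (x i - x j) / (x i + x j)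

lemma schurProd_perm {n : ℕ} (x : Fin n → ℝ) (σ : Equiv.Perm (Fin n)) :
    schurProd (fun i => x (σ i)) = ((Equiv.Perm.sign σ : ℤ) : ℝ) * schurProd x := by
  refine Equiv.Perm.prod_Ioi_comp_eq_sign_mul_prod σ
    (f := fun i j => (x i - x j) / (x i + x j)) fun i j => ?_
  rw [add_comm (x j), ← neg_div, neg_sub]

lemma schurProd_eq_ite {n : ℕ} (x : Fin n → ℝ) :
    schurProd x = ∏ i, ∏ j, if i < j then (x i - x j) / (x i + x j) else 1 := by
  unfold schurProd
  refine Finset.prod_congr rfl fun i _ => ?_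
  rw [← Finset.prod_filter]
  congr 1
  ext j; simp

lemma schurProd_succAbove {n : ℕ} (x : Fin (n + 1) → ℝ) (k : Fin (n + 1)) :
    schurProd x = (-1) ^ (k : ℕ)
      * (∏ i, (x k - x (k.succAbove i)) / (x k + x (k.succAbove i)))
      * schurProd (fun i => x (k.succAbove i)) := by
  rw [schurProd_eq_ite, schurProd_eq_ite, Fin.prod_univ_succAbove _ k]
  simp_rw [Fin.prod_univ_succAbove _ k]
  simp only [lt_irrefl, if_false, one_mul, Finset.prod_mul_distrib,
    Fin.succAbove_lt_succAbove_iff]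
  rw [← mul_assoc, ← Finset.prod_mul_distrib]
  congr 1
  have h1 : ∀ i : Fin n, ((if k < k.succAbove i
      then (x k - x (k.succAbove i)) / (x k + x (k.succAbove i)) else 1)
      * if k.succAbove i < k then (x (k.succAbove i) - x k) / (x (k.succAbove i) + x k) else 1)
      = (if i.castSucc < k then -1 else 1)
        * ((x k - x (k.succAbove i)) / (x k + x (k.succAbove i))) := by
    intro i
    rcases lt_or_gt_of_ne (Fin.succAbove_ne k i) with h | h
    · have h' : i.castSucc < k := Fin.succAbove_lt_iff_castSucc_lt k i |>.1 h
      rw [if_neg (not_lt.2 h.le), if_pos h, if_pos h', one_mul, add_comm (x k), neg_one_mul,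
        ← neg_div, neg_sub]
    · have h' : ¬ i.castSucc < k := fun h' =>
        absurd (Fin.succAbove_lt_iff_castSucc_lt k i |>.2 h') (not_lt.2 h.le)
      rw [if_pos h, if_neg (not_lt.2 h.le), if_neg h', one_mul, mul_one]
  rw [Finset.prod_congr rfl fun i _ => h1 i, Finset.prod_mul_distrib]
  congr 1
  rw [Finset.prod_ite, Finset.prod_const_one, mul_one, Finset.prod_const]
  congr 1
  have hcard : #{i : Fin n | (i : ℕ) < (k : ℕ)} = min n (k : ℕ) := Fin.card_filter_val_lt
  rw [min_eq_right (Nat.le_of_lt_succ k.2)] at hcard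
  simpa [Fin.lt_def] using hcard

/-- Partial fraction expansion of `∏_j (T−x_j) − ∏_j (T+x_j)` at the nodes `−x_j`. -/
lemma prod_sub_sub_prod_add {ι : Type*} [Fintype ι] [DecidableEq ι] (x : ι → ℝ)
    (hx : Function.Injective x) (T : ℝ) :
    ∏ j, (T - x j) - ∏ j, (T + x j)
      = -∑ j, 2 * x j * (∏ i ∈ Finset.univ.erase j, (x j + x i) / (x j - x i))
          * ∏ i ∈ Finset.univ.erase j, (T + x i) := by
  rcases isEmpty_or_nonempty ι with h | h
  · simp
  let f : Polynomial ℝ := ∏ j, (Polynomial.X - Polynomial.C (x j))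
    - ∏ j, (Polynomial.X - Polynomial.C (-x j))
  have hdeg : f.degree < ((Finset.univ : Finset ι).card : WithBot ℕ) := by
    have h1 : (∏ j, (Polynomial.X - Polynomial.C (x j))).degree
        = ((Finset.univ : Finset ι).card : WithBot ℕ) := by
      rw [Polynomial.degree_prod]; simp
    have h2 : (∏ j, (Polynomial.X - Polynomial.C (-x j))).degree
        = ((Finset.univ : Finset ι).card : WithBot ℕ) := by
      rw [Polynomial.degree_prod]; simp only [Polynomial.degree_X_sub_C]; simp
    rw [← h1]
    refine Polynomial.degree_sub_lt_left (h1.trans h2.symm) ?_ ?_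
    · exact Finset.prod_ne_zero_iff.2 fun i _ => Polynomial.X_sub_C_ne_zero _
    · rw [(Polynomial.monic_prod_X_sub_C x _).leadingCoeff,
        (Polynomial.monic_prod_X_sub_C (fun j => -x j) _).leadingCoeff]
  have hinj : Set.InjOn (fun j => -x j) ((Finset.univ : Finset ι) : Set ι) :=
    fun i _ j _ hij => hx (neg_injective hij)
  have key := congrArg (Polynomial.eval T) (Lagrange.eq_interpolate hinj hdeg)
  rw [Lagrange.interpolate_apply, Polynomial.eval_finsetSum] at key
  have hf : ∀ t, f.eval t = ∏ j, (t - x j) - ∏ j, (t + x j) := by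
    intro t
    simp [f, Polynomial.eval_prod]
  rw [hf] at key
  rw [key, ← Finset.sum_neg_distrib]
  refine Finset.sum_congr rfl fun j _ => ?_
  rw [Polynomial.eval_mul, Polynomial.eval_C, hf, Lagrange.basis, Polynomial.eval_prod]
  rw [Finset.prod_eq_zero (f := fun i => -x j + x i) (Finset.mem_univ j) (by simp), sub_zero,
    ← Finset.mul_prod_erase _ _ (Finset.mem_univ j), mul_assoc, ← Finset.prod_mul_distrib,
    mul_assoc (2 * x j), ← Finset.prod_mul_distrib]
  have : ∀ i ∈ Finset.univ.erase j, (-x j - x i)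
      * Polynomial.eval T (Lagrange.basisDivisor (-x j) (-x i))
      = (x j + x i) / (x j - x i) * (T + x i) := by
    intro i hi
    have hne : x j - x i ≠ 0 := sub_ne_zero.2 fun h => (Finset.ne_of_mem_erase hi) (hx h.symm)
    have hne' : -x j - -x i ≠ 0 := by
      intro h; apply hne; linarith
    simp only [Lagrange.basisDivisor, Polynomial.eval_mul, Polynomial.eval_C, Polynomial.eval_sub,
      Polynomial.eval_X]
    field_simp
    ring
  rw [Finset.prod_congr rfl this]
  ring

lemma sum_prod_add_div_sub {ι : Type*} [Fintype ι] [DecidableEq ι] (x : ι → ℝ)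
    (hx : Function.Injective x) (hpos : ∀ i, 0 < x i) :
    ∑ j, ∏ i ∈ Finset.univ.erase j, (x j + x i) / (x j - x i)
      = (1 - (-1) ^ Fintype.card ι) / 2 := by
  have h := prod_sub_sub_prod_add x hx 0
  have hP : (∏ j, x j) ≠ 0 := Finset.prod_ne_zero_iff.2 fun i _ => (hpos i).ne'
  have h2 : ∑ j, 2 * x j * (∏ i ∈ Finset.univ.erase j, (x j + x i) / (x j - x i))
          * ∏ i ∈ Finset.univ.erase j, (0 + x i)
      = 2 * (∏ j, x j) * ∑ j, ∏ i ∈ Finset.univ.erase j, (x j + x i) / (x j - x i) := by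
    rw [Finset.mul_sum]
    refine Finset.sum_congr rfl fun j _ => ?_
    rw [← Finset.mul_prod_erase _ x (Finset.mem_univ j)]
    simp only [zero_add]
    ring
  rw [h2] at h
  simp only [zero_sub, zero_add, Finset.prod_neg, Finset.card_univ] at h
  have : (∏ j, x j) * ((-1) ^ Fintype.card ι - 1 + 2 *
      ∑ j, ∏ i ∈ Finset.univ.erase j, (x j + x i) / (x j - x i)) = 0 := by linarith
  rcases mul_eq_zero.1 this with h | h
  · exact absurd h hP
  · linarith

lemma prod_sub_div_add {ι : Type*} [Fintype ι] [DecidableEq ι] (x : ι → ℝ)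
    (hx : Function.Injective x) (hpos : ∀ i, 0 < x i) {t : ℝ} (ht : 0 < t) :
    ∏ j, (t - x j) / (t + x j) = (1 + (-1) ^ Fintype.card ι) / 2
      + ∑ j, (t - x j) / (t + x j)
          * ∏ i ∈ Finset.univ.erase j, (x j + x i) / (x j - x i) := by
  have h := prod_sub_sub_prod_add x hx t
  have h1 := sum_prod_add_div_sub x hx hpos
  have hne : ∀ i, t + x i ≠ 0 := fun i => (add_pos ht (hpos i)).ne'
  have hP : (∏ j, (t + x j)) ≠ 0 := Finset.prod_ne_zero_iff.2 fun i _ => hne i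
  rw [Finset.prod_div_distrib, div_eq_iff hP, sub_eq_iff_eq_add.1 h]
  have h2 : (1 + (-1 : ℝ) ^ Fintype.card ι) / 2 = 1
      - ∑ j, ∏ i ∈ Finset.univ.erase j, (x j + x i) / (x j - x i) := by rw [h1]; ring
  rw [h2, add_mul, sub_mul, Finset.sum_mul, Finset.sum_mul, one_mul]
  have h3 : ∀ j, 2 * x j * (∏ i ∈ Finset.univ.erase j, (x j + x i) / (x j - x i))
      * ∏ i ∈ Finset.univ.erase j, (t + x i)
      = (∏ i ∈ Finset.univ.erase j, (x j + x i) / (x j - x i)) * ∏ i, (t + x i)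
        - (t - x j) / (t + x j) * (∏ i ∈ Finset.univ.erase j, (x j + x i) / (x j - x i))
          * ∏ i, (t + x i) := by
    intro j
    rw [← Finset.mul_prod_erase _ (fun i => t + x i) (Finset.mem_univ j)]
    have := hne j
    field_simp
    ring
  rw [Finset.sum_congr rfl fun j _ => h3 j, Finset.sum_sub_distrib]
  ring

/-- Expansion of the Schur product along its first variable. -/
lemma schurProd_expand {n : ℕ} (x : Fin (n + 2) → ℝ) (hx : Function.Injective x)
    (hpos : ∀ i, 0 < x i) :
    schurProd x = (1 + (-1) ^ (n + 1)) / 2 * schurProd (fun i : Fin (n + 1) => x i.succ)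
      + ∑ j : Fin (n + 1), (-1) ^ (j : ℕ) * ((x 0 - x j.succ) / (x 0 + x j.succ)
          * schurProd (fun i : Fin n => x (j.succAbove i).succ)) := by
  have hxs : Function.Injective (fun i : Fin (n + 1) => x i.succ) :=
    hx.comp (Fin.succ_injective _)
  rw [schurProd_succAbove x 0]
  simp only [Fin.val_zero, pow_zero, one_mul, Fin.succAbove_zero]
  rw [prod_sub_div_add _ hxs (fun i => hpos _) (hpos 0), Fintype.card_fin, add_mul, Finset.sum_mul]
  congr 1
  refine Finset.sum_congr rfl fun j _ => ?_
  rw [schurProd_succAbove (fun i : Fin (n + 1) => x i.succ) j]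
  have h1 : ∏ i ∈ Finset.univ.erase j, (x j.succ + x i.succ) / (x j.succ - x i.succ)
      = ∏ i, (x j.succ + x (j.succAbove i).succ) / (x j.succ - x (j.succAbove i).succ) := by
    have h0 := Fin.univ_succAbove n j
    rw [h0, Finset.erase_cons, Finset.prod_map]
    rfl
  have h2 : (∏ i, (x j.succ + x (j.succAbove i).succ) / (x j.succ - x (j.succAbove i).succ))
      * (∏ i, (x j.succ - x (j.succAbove i).succ) / (x j.succ + x (j.succAbove i).succ)) = 1 := by
    rw [← Finset.prod_mul_distrib]
    refine Finset.prod_eq_one fun i _ => ?_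
    have a1 : x j.succ - x (j.succAbove i).succ ≠ 0 := sub_ne_zero.2 fun h =>
      Fin.succAbove_ne j i (hxs h).symm
    have a2 : x j.succ + x (j.succAbove i).succ ≠ 0 := (add_pos (hpos _) (hpos _)).ne'
    field_simp
  rw [h1]
  linear_combination (-1) ^ (j : ℕ) * ((x 0 - x j.succ) / (x 0 + x j.succ))
    * schurProd (fun i : Fin n => x (j.succAbove i).succ) * h2

/-- Lebesgue measure on the open half-line. -/
abbrev posVol : Measure ℝ := volume.restrict (Set.Ioi 0)

lemma pi_posVol (n : ℕ) : Measure.pi (fun _ : Fin n => posVol)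
    = volume.restrict (Set.univ.pi fun _ : Fin n => Set.Ioi (0 : ℝ)) := by
  rw [volume_pi, Measure.restrict_pi_pi]

lemma ae_pos_pi (n : ℕ) : ∀ᵐ x ∂Measure.pi (fun _ : Fin n => posVol), ∀ i, 0 < x i := by
  rw [pi_posVol]
  filter_upwards [ae_restrict_mem (MeasurableSet.univ_pi fun _ => measurableSet_Ioi)] with x hx i
  exact hx i (Set.mem_univ i)

lemma ae_injective_pi (n : ℕ) :
    ∀ᵐ x ∂Measure.pi (fun _ : Fin n => posVol), Function.Injective x := by
  rw [pi_posVol]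
  refine ae_restrict_of_ae ?_
  have h : ∀ i j : Fin n, i ≠ j → ∀ᵐ x : Fin n → ℝ, x i ≠ x j := by
    intro i j hij
    let p : Submodule ℝ (Fin n → ℝ) :=
      LinearMap.ker (LinearMap.proj (R := ℝ) (φ := fun _ : Fin n => ℝ) i
        - LinearMap.proj (R := ℝ) (φ := fun _ : Fin n => ℝ) j)
    have hp : p ≠ ⊤ := by
      intro h
      have : Pi.single i (1 : ℝ) ∈ p := h ▸ Submodule.mem_top
      simp [p, Pi.single_eq_of_ne' hij] at this
    have h0 := Measure.addHaar_submodule (volume : Measure (Fin n → ℝ)) p hp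
    rw [ae_iff]
    refine measure_mono_null (fun x hx => ?_) h0
    simp only [ne_eq, not_not, Set.mem_ofPred_eq] at hx
    simp [p, hx]
  have h' : ∀ᵐ x : Fin n → ℝ, ∀ i j : Fin n, i ≠ j → x i ≠ x j := by
    rw [ae_all_iff]; intro i
    rw [ae_all_iff]; intro j
    by_cases hij : i = j
    · exact Filter.Eventually.of_forall fun x hn => absurd hij hn
    · filter_upwards [h i j hij] with x hx _ using hx
  filter_upwards [h'] with x hx i j hij
  by_contra hne
  exact hx i j hne hij

lemma abs_sub_div_add_le_one {x y : ℝ} (hx : 0 < x) (hy : 0 < y) :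
    |(x - y) / (x + y)| ≤ 1 := by
  rw [abs_div, abs_of_pos (add_pos hx hy), div_le_one (add_pos hx hy), abs_le]
  constructor <;> linarith

lemma abs_schurProd_le_one {n : ℕ} {x : Fin n → ℝ} (hx : ∀ i, 0 < x i) : |schurProd x| ≤ 1 := by
  unfold schurProd
  rw [Finset.abs_prod]
  refine Finset.prod_le_one (fun i _ => abs_nonneg _) fun i _ => ?_
  rw [Finset.abs_prod]
  exact Finset.prod_le_one (fun i _ => abs_nonneg _)
    fun j _ => abs_sub_div_add_le_one (hx i) (hx j)

@[fun_prop]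
lemma measurable_schurProd {n : ℕ} : Measurable (schurProd (n := n)) := by
  unfold schurProd
  fun_prop

lemma integral_pi_succAbove {n : ℕ} (μ : Measure ℝ) [SigmaFinite μ] (k : Fin (n + 1))
    (G : ℝ × (Fin n → ℝ) → ℝ) :
    ∫ x, G (x k, fun i => x (k.succAbove i)) ∂Measure.pi (fun _ : Fin (n + 1) => μ)
      = ∫ p, G p ∂μ.prod (Measure.pi fun _ : Fin n => μ) :=
  (measurePreserving_piFinSuccAbove (fun _ : Fin (n + 1) => μ) k).integral_comp' G

lemma integral_pi_succ_succAbove {n : ℕ} (μ : Measure ℝ) [SigmaFinite μ] (j : Fin (n + 1))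
    (G : (ℝ × ℝ) × (Fin n → ℝ) → ℝ) :
    ∫ x, G ((x 0, x j.succ), fun i => x (j.succAbove i).succ)
        ∂Measure.pi (fun _ : Fin (n + 2) => μ)
      = ∫ p, G p ∂(μ.prod μ).prod (Measure.pi fun _ : Fin n => μ) := by
  have h0 := measurePreserving_piFinSuccAbove (fun _ : Fin (n + 2) => μ) 0
  have h1 := measurePreserving_piFinSuccAbove (fun _ : Fin (n + 1) => μ) j
  have h2 := (MeasurePreserving.id μ).prod h1
  have h3 := (measurePreserving_prodAssoc μ μ (Measure.pi fun _ : Fin n => μ)).symm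
  have h4 := (h3.comp h2).comp h0
  rw [← (h4.integral_comp ?_ G)]
  · rfl
  · exact (MeasurableEquiv.measurableEmbedding _).comp
      (((MeasurableEmbedding.id).prodMap (MeasurableEquiv.measurableEmbedding _))) |>.comp
      (MeasurableEquiv.measurableEmbedding _)

/-- If every pair integral of `(x−y)/(x+y)` reproduces the kernel at the parameters `z`, then the
integral of the Schur product reproduces the Schur product at `z`. -/
lemma integral_schurProd_mul_prod {n : ℕ} (z : Fin n → ℝ) (w : Fin n → ℝ → ℝ)
    (hz : ∀ i, 0 < z i) (hinj : Function.Injective z) (hw : ∀ i, Integrable (w i) posVol)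
    (hpair : ∀ i j, ∫ p : ℝ × ℝ, (p.1 - p.2) / (p.1 + p.2) * (w i p.1 * w j p.2)
        ∂posVol.prod posVol
      = (z i - z j) / (z i + z j) * ((∫ x, w i x ∂posVol) * ∫ x, w j x ∂posVol)) :
    ∫ x, schurProd x * ∏ i, w i (x i) ∂Measure.pi (fun _ : Fin n => posVol)
      = schurProd z * ∏ i, ∫ x, w i x ∂posVol := by
  induction n using Nat.twoStepInduction with
  | zero =>
    have h : ∀ x : Fin 0 → ℝ, schurProd x = 1 := fun x => by simp [schurProd]
    simp only [h, one_mul]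
    rw [integral_fintype_prod_eq_prod]
  | one =>
    have h : ∀ x : Fin 1 → ℝ, schurProd x = 1 := fun x => by simp [schurProd]
    simp only [h, one_mul]
    rw [integral_fintype_prod_eq_prod]
  | more n ih0 ih1 =>
    have hint := Integrable.fintype_prod (μ := fun _ : Fin (n + 2) => posVol) hw
    have hexp : ∀ᵐ x ∂Measure.pi (fun _ : Fin (n + 2) => posVol),
        schurProd x * ∏ i, w i (x i)
        = (1 + (-1) ^ (n + 1)) / 2 * (schurProd (fun i : Fin (n + 1) => x i.succ)
              * ∏ i, w i (x i))
          + ∑ j : Fin (n + 1), (-1) ^ (j : ℕ) * (((x 0 - x j.succ) / (x 0 + x j.succ)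
            * schurProd (fun i : Fin n => x (j.succAbove i).succ)) * ∏ i, w i (x i)) := by
      filter_upwards [ae_pos_pi (n + 2), ae_injective_pi (n + 2)] with x hx hxi
      rw [schurProd_expand x hxi hx, add_mul, Finset.sum_mul]
      simp only [mul_assoc]
    have hi1 : Integrable (fun x : Fin (n + 2) → ℝ =>
        schurProd (fun i : Fin (n + 1) => x i.succ) * ∏ i, w i (x i))
        (Measure.pi (fun _ : Fin (n + 2) => posVol)) := by
      refine hint.bdd_mul (c := 1) (Measurable.aestronglyMeasurable (by fun_prop)) ?_
      filter_upwards [ae_pos_pi (n + 2)] with x hx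
      exact abs_schurProd_le_one fun i => hx _
    have hi2 : ∀ j : Fin (n + 1), Integrable (fun x : Fin (n + 2) → ℝ =>
        ((x 0 - x j.succ) / (x 0 + x j.succ)
            * schurProd (fun i : Fin n => x (j.succAbove i).succ)) * ∏ i, w i (x i))
        (Measure.pi (fun _ : Fin (n + 2) => posVol)) := by
      intro j
      refine hint.bdd_mul (c := 1) (Measurable.aestronglyMeasurable (by fun_prop)) ?_
      filter_upwards [ae_pos_pi (n + 2)] with x hx
      rw [Real.norm_eq_abs, abs_mul]
      exact mul_le_one₀ (abs_sub_div_add_le_one (hx _) (hx _)) (abs_nonneg _)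
        (abs_schurProd_le_one fun i => hx _)
    rw [integral_congr_ae hexp, integral_add (hi1.const_mul _)
      (integrable_finsetSum _ fun j _ => (hi2 j).const_mul _), integral_const_mul,
      integral_finsetSum _ fun j _ => (hi2 j).const_mul _]
    have e1 : ∫ x, schurProd (fun i : Fin (n + 1) => x i.succ) * ∏ i, w i (x i)
        ∂Measure.pi (fun _ : Fin (n + 2) => posVol)
        = schurProd (fun i : Fin (n + 1) => z i.succ) * ∏ i, ∫ x, w i x ∂posVol := by
      have := integral_pi_succAbove posVol (0 : Fin (n + 2))
        (fun p => w 0 p.1 * (schurProd p.2 * ∏ i, w i.succ (p.2 i)))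
      rw [integral_prod_mul (w 0)
        (fun y : Fin (n + 1) → ℝ => schurProd y * ∏ i, w i.succ (y i)), ih1 (fun i => z i.succ) (fun i => w i.succ) (fun i => hz _)
        (hinj.comp (Fin.succ_injective _)) (fun i => hw _) (fun i j => hpair _ _)] at this
      rw [Fin.prod_univ_succ]
      simp only [Fin.prod_univ_succ (fun i => w i _)]
      simp only [Fin.succAbove_zero] at this
      rw [mul_left_comm, ← this]
      congr 1
      ext x
      ring
    have e2 : ∀ j : Fin (n + 1), ∫ x : Fin (n + 2) → ℝ, ((x 0 - x j.succ) / (x 0 + x j.succ)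
            * schurProd (fun i : Fin n => x (j.succAbove i).succ)) * ∏ i, w i (x i)
        ∂Measure.pi (fun _ : Fin (n + 2) => posVol)
        = ((z 0 - z j.succ) / (z 0 + z j.succ)
            * schurProd (fun i : Fin n => z (j.succAbove i).succ))
          * ∏ i, ∫ x, w i x ∂posVol := by
      intro j
      have := integral_pi_succ_succAbove posVol j
        (fun p => ((p.1.1 - p.1.2) / (p.1.1 + p.1.2) * (w 0 p.1.1 * w j.succ p.1.2))
          * (schurProd p.2 * ∏ i, w (j.succAbove i).succ (p.2 i)))
      rw [integral_prod_mul (fun p : ℝ × ℝ => (p.1 - p.2) / (p.1 + p.2)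
          * (w 0 p.1 * w j.succ p.2))
          (fun y : Fin n → ℝ => schurProd y * ∏ i, w (j.succAbove i).succ (y i)), hpair,
        ih0 (fun i => z (j.succAbove i).succ) (fun i => w (j.succAbove i).succ) (fun i => hz _)
        (hinj.comp ((Fin.succ_injective _).comp Fin.succAbove_right_injective)) (fun i => hw _)
          (fun i j => hpair _ _)] at this
      rw [Fin.prod_univ_succ, Fin.prod_univ_succAbove _ j]
      simp only [Fin.prod_univ_succ (fun i => w i _),
        Fin.prod_univ_succAbove (fun i : Fin (n + 1) => w i.succ _) j]
      refine Eq.trans ?_ (this.trans ?_)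
      · congr 1
        ext x
        ring
      · ring
    rw [e1]
    simp only [integral_const_mul, e2]
    rw [schurProd_expand z hinj hz, add_mul, Finset.sum_mul]
    simp only [mul_assoc]

lemma measurableSet_orthant (m : ℕ) : MeasurableSet (orthant m) := by
  have : orthant m = Set.univ.pi fun _ : Fin m => Set.Ici (0 : ℝ) := by
    ext x; simp [orthant, Pi.le_def]
  rw [this]
  exact MeasurableSet.univ_pi fun _ => measurableSet_Ici

lemma measurableSet_simplexDom (m : ℕ) : MeasurableSet (simplexDom m) := by
  have h1 : MeasurableSet {l : Fin (m - 1) → ℝ | ∑ i, l i ≤ 1} :=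
    measurableSet_le (by fun_prop) measurable_const
  exact (measurableSet_orthant (m - 1)).inter h1

lemma restrict_orthant (m : ℕ) :
    volume.restrict (orthant m) = Measure.pi (fun _ : Fin m => posVol) := by
  have : orthant m = Set.univ.pi fun _ : Fin m => Set.Ici (0 : ℝ) := by
    ext x; simp [orthant, Pi.le_def]
  rw [this, volume_pi, Measure.restrict_pi_pi]
  congr 1
  ext1 i
  exact Measure.restrict_congr_set Ioi_ae_eq_Ici.symm

lemma measurePreserving_simplex_shear (n : ℕ) :
    MeasurePreserving (fun p : (Fin n → ℝ) × ℝ => fun i : Fin (n + 1) =>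
      if h : (i : ℕ) < n then p.1 ⟨i, h⟩ else p.2 - ∑ j, p.1 j) (volume.prod volume) volume := by
  have h1 : MeasurePreserving (fun p : (Fin n → ℝ) × ℝ => (p.1, p.2 - ∑ j, p.1 j))
      (volume.prod volume) (volume.prod volume) := by
    refine (MeasurePreserving.id (volume : Measure (Fin n → ℝ))).skew_product
      (g := fun (y : Fin n → ℝ) (r : ℝ) => r - ∑ j, y j) ?_ ?_
    · simp only [Function.uncurry_def]
      fun_prop
    · exact Filter.Eventually.of_forall fun y =>
        (measurePreserving_sub_right (volume : Measure ℝ) (∑ j, y j)).map_eq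
  have h2 : MeasurePreserving (Prod.swap : (Fin n → ℝ) × ℝ → ℝ × (Fin n → ℝ))
      (volume.prod volume) (volume.prod volume) := Measure.measurePreserving_swap
  have h3 := (volume_preserving_piFinSuccAbove (fun _ : Fin (n + 1) => ℝ) (Fin.last n)).symm
  have h4 := (h3.comp h2).comp h1
  have heq : (fun p : (Fin n → ℝ) × ℝ => fun i : Fin (n + 1) =>
      if h : (i : ℕ) < n then p.1 ⟨i, h⟩ else p.2 - ∑ j, p.1 j)
      = ((MeasurableEquiv.piFinSuccAbove (fun _ : Fin (n + 1) => ℝ) (Fin.last n)).symm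
        ∘ Prod.swap) ∘ fun p : (Fin n → ℝ) × ℝ => (p.1, p.2 - ∑ j, p.1 j) := by
    funext p i
    refine Fin.lastCases ?_ (fun i => ?_) i
    · simp [Fin.insertNthEquiv]
    · simp [Fin.insertNthEquiv, Fin.insertNth_last']
  rw [heq]
  exact h4

/-- Polar-type decomposition of integrals over the orthant along the dilated simplices. -/
lemma integral_orthant_eq_integral_simplex (n : ℕ) (F : (Fin (n + 1) → ℝ) → ℝ)
    (hF : IntegrableOn F (orthant (n + 1))) :
    ∫ x in orthant (n + 1), F x
      = ∫ r in Set.Ioi (0 : ℝ), r ^ n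
          * ∫ l in simplexDom (n + 1), F (fun i => r * simplexExt (n + 1) l i) := by
  set F' := (orthant (n + 1)).indicator F with hF'
  have hint : Integrable F' := hF.integrable_indicator (measurableSet_orthant _)
  have hmp := measurePreserving_simplex_shear n
  rw [← integral_indicator (measurableSet_orthant _), ← hF', ← hmp.map_eq, integral_map
    hmp.aemeasurable (by rw [hmp.map_eq]; exact hint.aestronglyMeasurable)]
  refine (integral_prod_symm _ (hmp.integrable_comp_of_integrable hint)).trans ?_
  have hneg : ∀ r : ℝ, r ∉ Set.Ici (0 : ℝ) → ∫ y : Fin n → ℝ,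
      F' (fun i => if h : (i : ℕ) < n then y ⟨i, h⟩ else r - ∑ j, y j) = 0 := by
    intro r hr
    refine integral_eq_zero_of_ae (Filter.Eventually.of_forall fun y => ?_)
    refine Set.indicator_of_notMem (fun hy => hr ?_) F
    have h1 : ∀ j : Fin n, 0 ≤ y j := fun j => by simpa using hy j.castSucc
    have h2 : 0 ≤ r - ∑ j, y j := by simpa using hy (Fin.last n)
    have h3 := Finset.sum_nonneg fun j (_ : j ∈ Finset.univ) => h1 j
    exact Set.mem_Ici.2 (by linarith)
  refine (setIntegral_eq_integral_of_forall_compl_eq_zero hneg).symm.trans ?_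
  rw [integral_Ici_eq_integral_Ioi]
  refine setIntegral_congr_fun measurableSet_Ioi fun r hr => ?_
  have hr : 0 < r := hr
  have hsc := Measure.integral_comp_smul (volume : Measure (Fin n → ℝ))
    (fun y => F' (fun i => if h : (i : ℕ) < n then y ⟨i, h⟩ else r - ∑ j, y j)) r
  rw [Module.finrank_fin_fun, abs_of_pos (by positivity), smul_eq_mul,
    eq_inv_mul_iff_mul_eq₀ (by positivity)] at hsc
  refine hsc.symm.trans ?_
  congr 1
  rw [← integral_indicator (measurableSet_simplexDom _)]
  refine integral_congr_ae (Filter.Eventually.of_forall fun (l : Fin n → ℝ) => ?_)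
  have hext : (fun i : Fin (n + 1) => if h : (i : ℕ) < n then (r • l) ⟨i, h⟩
      else r - ∑ j, (r • l) j) = fun i => r * simplexExt (n + 1) l i := by
    funext i
    simp only [simplexExt, Nat.add_sub_cancel, Pi.smul_apply, smul_eq_mul, ← Finset.mul_sum]
    split_ifs with h
    · rfl
    · exact (by ring : r - r * ∑ j, l j = r * (1 - ∑ j, l j))
  have hmem : (fun i => r * simplexExt (n + 1) l i) ∈ orthant (n + 1)
      ↔ l ∈ simplexDom (n + 1) := by
    constructor
    · intro h
      refine ⟨fun j : Fin n => ?_, ?_⟩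
      · have := nonneg_of_mul_nonneg_right (h j.castSucc) hr
        simpa [simplexExt] using this
      · have := nonneg_of_mul_nonneg_right (h (Fin.last n)) hr
        simp only [simplexExt, Fin.val_last, Nat.add_sub_cancel, lt_irrefl, dite_false] at this
        exact sub_nonneg.1 this
    · rintro ⟨h1, h2⟩ i
      refine mul_nonneg hr.le ?_
      unfold simplexExt
      split_ifs with h
      · exact h1 _
      · exact sub_nonneg.2 h2
  change F' (fun i : Fin (n + 1) => if h : (i : ℕ) < n then (r • l) ⟨i, h⟩
      else r - ∑ j, (r • l) j) = _
  rw [hext, hF']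
  by_cases h : l ∈ simplexDom (n + 1)
  · rw [Set.indicator_of_mem h, Set.indicator_of_mem (hmem.2 h)]
  · rw [Set.indicator_of_notMem h, Set.indicator_of_notMem (mt hmem.1 h)]

lemma integral_orthant_of_homogeneous (n : ℕ) (F G : (Fin (n + 1) → ℝ) → ℝ) (φ : ℝ → ℝ)
    (hF : IntegrableOn F (orthant (n + 1)))
    (h : ∀ r > 0, ∀ l ∈ simplexDom (n + 1), F (fun i => r * simplexExt (n + 1) l i)
      = φ r * G (simplexExt (n + 1) l)) :
    ∫ x in orthant (n + 1), F x = (∫ r in Set.Ioi (0 : ℝ), r ^ n * φ r)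
      * ∫ l in simplexDom (n + 1), G (simplexExt (n + 1) l) := by
  rw [integral_orthant_eq_integral_simplex n F hF, ← integral_mul_const]
  refine setIntegral_congr_fun measurableSet_Ioi fun r hr => ?_
  rw [setIntegral_congr_fun (measurableSet_simplexDom _) (h r hr), integral_const_mul]
  exact (mul_assoc _ _ _).symm

lemma simplexExt_nonneg {m : ℕ} {l : Fin (m - 1) → ℝ} (hl : l ∈ simplexDom m) (i : Fin m) :
    0 ≤ simplexExt m l i := by
  unfold simplexExt
  split_ifs with h
  · exact hl.1 _
  · exact sub_nonneg.2 hl.2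

lemma sum_simplexExt (n : ℕ) (l : Fin (n + 1 - 1) → ℝ) : ∑ i, simplexExt (n + 1) l i = 1 := by
  rw [Fin.sum_univ_castSucc]
  simp [simplexExt]

lemma integrable_gammaWeight {z : ℝ} (hz : 0 < z) :
    Integrable (fun x => Real.exp (-x) * x ^ (z - 1)) posVol := Real.GammaIntegral_convergent hz

lemma integral_gammaWeight {z : ℝ} (hz : 0 < z) :
    ∫ x, Real.exp (-x) * x ^ (z - 1) ∂posVol = Real.Gamma z := (Real.Gamma_eq_integral hz).symm

lemma ae_pos_prod : ∀ᵐ p : ℝ × ℝ ∂posVol.prod posVol, 0 < p.1 ∧ 0 < p.2 := by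
  rw [Measure.prod_restrict]
  filter_upwards [ae_restrict_mem (measurableSet_Ioi.prod measurableSet_Ioi)] with p hp using hp

lemma integrable_div_add_mul {p q : ℝ} (hp : 0 < p) (hq : 0 < q) :
    Integrable (fun x : ℝ × ℝ => (x.1 / (x.1 + x.2))
      * ((Real.exp (-x.1) * x.1 ^ (p - 1)) * (Real.exp (-x.2) * x.2 ^ (q - 1))))
      (posVol.prod posVol) := by
  refine ((integrable_gammaWeight hp).mul_prod (integrable_gammaWeight hq)).bdd_mul (c := 1)
    (Measurable.aestronglyMeasurable (by fun_prop)) ?_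
  filter_upwards [ae_pos_prod] with x hx
  have h := add_pos hx.1 hx.2
  rw [Real.norm_eq_abs, abs_of_nonneg (div_nonneg hx.1.le h.le), div_le_one h]
  linarith [hx.2]

lemma integral_posVol_prod_eq (f : ℝ × ℝ → ℝ) :
    ∫ p, f p ∂posVol.prod posVol = ∫ x in orthant 2, f (x 0, x 1) := by
  rw [restrict_orthant]
  exact ((measurePreserving_finTwoArrow posVol).integral_comp' f).symm

lemma integrableOn_orthant_two {f : ℝ × ℝ → ℝ} (hf : Integrable f (posVol.prod posVol)) :
    IntegrableOn (fun x : Fin 2 → ℝ => f (x 0, x 1)) (orthant 2) := by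
  rw [IntegrableOn, restrict_orthant]
  exact (measurePreserving_finTwoArrow posVol).integrable_comp_of_integrable hf

lemma integral_div_add_mul {p q : ℝ} (hp : 0 < p) (hq : 0 < q) :
    ∫ x : ℝ × ℝ, (x.1 / (x.1 + x.2))
      * ((Real.exp (-x.1) * x.1 ^ (p - 1)) * (Real.exp (-x.2) * x.2 ^ (q - 1)))
      ∂posVol.prod posVol = p / (p + q) * (Real.Gamma p * Real.Gamma q) := by
  have hp1 : 0 < p + 1 := by linarith
  have hpq : 0 < p + q := by linarith
  have hcongr : (fun x : ℝ × ℝ => (x.1 / (x.1 + x.2))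
      * ((Real.exp (-x.1) * x.1 ^ (p - 1)) * (Real.exp (-x.2) * x.2 ^ (q - 1))))
      =ᵐ[posVol.prod posVol] fun x : ℝ × ℝ =>
        ((Real.exp (-x.1) * x.1 ^ (p + 1 - 1)) * (Real.exp (-x.2) * x.2 ^ (q - 1)))
          / (x.1 + x.2) := by
    filter_upwards [ae_pos_prod] with x hx
    rw [show p + 1 - 1 = (p - 1) + 1 by ring, Real.rpow_add_one hx.1.ne']
    ring
  have e0 := integral_prod_mul (μ := posVol) (ν := posVol)
    (fun x : ℝ => Real.exp (-x) * x ^ (p + 1 - 1)) (fun x : ℝ => Real.exp (-x) * x ^ (q - 1))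
  rw [integral_gammaWeight hp1, integral_gammaWeight hq, integral_posVol_prod_eq] at e0
  have hexp : ∀ r : ℝ, ∀ l : Fin (1 + 1 - 1) → ℝ, Real.exp (-(r * simplexExt (1 + 1) l 0))
      * Real.exp (-(r * simplexExt (1 + 1) l 1)) = Real.exp (-r) := by
    intro r l
    have := sum_simplexExt 1 l
    rw [Fin.sum_univ_two] at this
    rw [← Real.exp_add]
    congr 1
    linear_combination (-r) * this
  have e1 := integral_orthant_of_homogeneous 1
    (fun x => (Real.exp (-x 0) * x 0 ^ (p + 1 - 1)) * (Real.exp (-x 1) * x 1 ^ (q - 1)))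
    (fun x => x 0 ^ (p + 1 - 1) * x 1 ^ (q - 1)) (fun r => Real.exp (-r) * r ^ (p + q - 1))
    (integrableOn_orthant_two
      ((integrable_gammaWeight hp1).mul_prod (integrable_gammaWeight hq)))
    (fun r hr l hl => by
      have hr : 0 < r := hr
      rw [Real.mul_rpow hr.le (simplexExt_nonneg hl _), Real.mul_rpow hr.le
        (simplexExt_nonneg hl _), ← hexp r l, show p + q - 1 = (p + 1 - 1) + (q - 1) by ring,
        Real.rpow_add hr]
      ring)
  have e2 := integral_orthant_of_homogeneous 1
    (fun x => ((Real.exp (-x 0) * x 0 ^ (p + 1 - 1)) * (Real.exp (-x 1) * x 1 ^ (q - 1)))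
      / (x 0 + x 1))
    (fun x => x 0 ^ (p + 1 - 1) * x 1 ^ (q - 1))
    (fun r => Real.exp (-r) * r ^ (p + q - 1) / r)
    (integrableOn_orthant_two ((integrable_div_add_mul hp hq).congr hcongr))
    (fun r hr l hl => by
      have hr : 0 < r := hr
      have hs := sum_simplexExt 1 l
      rw [Fin.sum_univ_two] at hs
      rw [Real.mul_rpow hr.le (simplexExt_nonneg hl _), Real.mul_rpow hr.le
        (simplexExt_nonneg hl _), ← hexp r l, show p + q - 1 = (p + 1 - 1) + (q - 1) by ring,
        Real.rpow_add hr, ← mul_add, hs]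
      ring)
  have r1 : ∫ r in Set.Ioi (0 : ℝ), r ^ 1 * (Real.exp (-r) * r ^ (p + q - 1))
      = Real.Gamma (p + q + 1) := by
    rw [Real.Gamma_eq_integral (by linarith)]
    refine setIntegral_congr_fun measurableSet_Ioi fun r hr => ?_
    have hr : 0 < r := hr
    rw [show p + q + 1 - 1 = (p + q - 1) + 1 by ring, Real.rpow_add_one hr.ne']
    ring
  have r2 : ∫ r in Set.Ioi (0 : ℝ), r ^ 1 * (Real.exp (-r) * r ^ (p + q - 1) / r)
      = Real.Gamma (p + q) := by
    rw [Real.Gamma_eq_integral hpq]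
    refine setIntegral_congr_fun measurableSet_Ioi fun r hr => ?_
    have hr : 0 < r := hr
    field_simp
  rw [r1, Real.Gamma_add_one hpq.ne'] at e1
  rw [r2] at e2
  have e3 := e0.symm.trans e1
  rw [Real.Gamma_add_one hp.ne'] at e3
  rw [integral_congr_ae hcongr, integral_posVol_prod_eq]
  refine e2.trans ?_
  field_simp
  linear_combination -e3

lemma integral_pair_gammaWeight {p q : ℝ} (hp : 0 < p) (hq : 0 < q) :
    ∫ x : ℝ × ℝ, (x.1 - x.2) / (x.1 + x.2)
      * ((Real.exp (-x.1) * x.1 ^ (p - 1)) * (Real.exp (-x.2) * x.2 ^ (q - 1)))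
      ∂posVol.prod posVol = (p - q) / (p + q) * (Real.Gamma p * Real.Gamma q) := by
  have hi := integrable_div_add_mul hp hq
  have hi' := integrable_div_add_mul hq hp
  have hv := integral_div_add_mul hq hp
  rw [← integral_prod_swap] at hv
  have := integral_sub hi hi'.swap
  simp only [Function.comp, Prod.fst_swap, Prod.snd_swap] at this hv
  rw [integral_div_add_mul hp hq, hv] at this
  rw [show (p - q) / (p + q) * (Real.Gamma p * Real.Gamma q)
    = p / (p + q) * (Real.Gamma p * Real.Gamma q)
      - q / (q + p) * (Real.Gamma q * Real.Gamma p) by rw [add_comm q p]; ring, ← this]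
  congr 1
  ext x
  rw [add_comm x.2 x.1]
  ring

lemma abs_rpow_mul_log_le {x t s δ : ℝ} (hx : 0 < x) (hδ : 0 < δ) (ht : |t - s| < δ) :
    |x ^ (t - 1) * Real.log x| ≤ (x ^ (s - 1 + 2 * δ) + x ^ (s - 1 - 2 * δ)) / δ := by
  obtain ⟨h1, h2⟩ := abs_lt.1 ht
  have hp1 := Real.rpow_pos_of_pos hx (s - 1 + 2 * δ)
  have hp2 := Real.rpow_pos_of_pos hx (s - 1 - 2 * δ)
  have hp3 := Real.rpow_pos_of_pos hx (t - 1)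
  rw [abs_mul, abs_of_pos hp3, le_div_iff₀ hδ]
  rcases le_total 1 x with h | h
  · rw [abs_of_nonneg (Real.log_nonneg h)]
    have hl := (le_div_iff₀ hδ).1 (Real.log_le_rpow_div hx.le hδ)
    calc x ^ (t - 1) * Real.log x * δ = x ^ (t - 1) * (Real.log x * δ) := by ring
      _ ≤ x ^ (t - 1) * x ^ δ := by gcongr
      _ = x ^ (t - 1 + δ) := (Real.rpow_add hx _ _).symm
      _ ≤ x ^ (s - 1 + 2 * δ) := Real.rpow_le_rpow_of_exponent_le h (by linarith)
      _ ≤ _ := by linarith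
  · rw [abs_of_nonpos (Real.log_nonpos hx.le h), ← Real.log_inv]
    have hl := (le_div_iff₀ hδ).1 (Real.log_le_rpow_div (inv_pos.2 hx).le hδ)
    rw [Real.inv_rpow hx.le, ← Real.rpow_neg hx.le] at hl
    calc x ^ (t - 1) * Real.log x⁻¹ * δ = x ^ (t - 1) * (Real.log x⁻¹ * δ) := by ring
      _ ≤ x ^ (t - 1) * x ^ (-δ) := by gcongr
      _ = x ^ (t - 1 + -δ) := (Real.rpow_add hx _ _).symm
      _ ≤ x ^ (s - 1 - 2 * δ) := Real.rpow_le_rpow_of_exponent_ge hx h (by linarith)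
      _ ≤ _ := by linarith

lemma rpow_le_add_rpow {x s ε : ℝ} (hx : 0 < x) (hε : 0 < ε) :
    x ^ s ≤ x ^ (s + ε) + x ^ (s - ε) := by
  have hp1 := Real.rpow_pos_of_pos hx (s + ε)
  have hp2 := Real.rpow_pos_of_pos hx (s - ε)
  rcases le_total 1 x with h | h
  · linarith [Real.rpow_le_rpow_of_exponent_le h (by linarith : s ≤ s + ε)]
  · linarith [Real.rpow_le_rpow_of_exponent_ge hx h (by linarith : s - ε ≤ s)]

/-- Differentiation of a Mellin-type integral `∫ H·X^(s−1)` with respect to the exponent. -/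
lemma hasDerivAt_integral_rpow {Ω : Type*} [MeasurableSpace Ω] {μ : Measure Ω} {X H : Ω → ℝ}
    (hX : Measurable X) (hH : Measurable H) (hpos : ∀ᵐ ω ∂μ, 0 < X ω) {s δ : ℝ} (hδ : 0 < δ)
    (h1 : Integrable (fun ω => H ω * X ω ^ (s - 1 + 2 * δ)) μ)
    (h2 : Integrable (fun ω => H ω * X ω ^ (s - 1 - 2 * δ)) μ) :
    Integrable (fun ω => H ω * (X ω ^ (s - 1) * Real.log (X ω))) μ ∧
      HasDerivAt (fun t => ∫ ω, H ω * X ω ^ (t - 1) ∂μ)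
        (∫ ω, H ω * (X ω ^ (s - 1) * Real.log (X ω)) ∂μ) s := by
  have hadd : ∀ᵐ ω ∂μ, ‖H ω * X ω ^ (s - 1 + 2 * δ)‖ + ‖H ω * X ω ^ (s - 1 - 2 * δ)‖
      = |H ω| * (X ω ^ (s - 1 + 2 * δ) + X ω ^ (s - 1 - 2 * δ)) := by
    filter_upwards [hpos] with ω hω
    rw [Real.norm_eq_abs, Real.norm_eq_abs, abs_mul, abs_mul,
      abs_of_pos (Real.rpow_pos_of_pos hω _), abs_of_pos (Real.rpow_pos_of_pos hω _), mul_add]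
  have hb : Integrable (fun ω => |H ω| * (X ω ^ (s - 1 + 2 * δ) + X ω ^ (s - 1 - 2 * δ))) μ :=
    (h1.norm.add h2.norm).congr hadd
  refine hasDerivAt_integral_of_dominated_loc_of_deriv_le
    (F := fun t ω => H ω * X ω ^ (t - 1))
    (F' := fun t ω => H ω * (X ω ^ (t - 1) * Real.log (X ω)))
    (bound := fun ω => |H ω| * (X ω ^ (s - 1 + 2 * δ) + X ω ^ (s - 1 - 2 * δ)) / δ)
    (s := Metric.ball s δ) (Metric.ball_mem_nhds s hδ) ?_ ?_ ?_ ?_ (hb.div_const δ) ?_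
  · exact Filter.Eventually.of_forall fun t => Measurable.aestronglyMeasurable (by fun_prop)
  · refine hb.mono' (Measurable.aestronglyMeasurable (by fun_prop)) ?_
    filter_upwards [hpos] with ω hω
    rw [Real.norm_eq_abs, abs_mul, abs_of_pos (Real.rpow_pos_of_pos hω (s - 1))]
    exact mul_le_mul_of_nonneg_left (rpow_le_add_rpow hω (by linarith)) (abs_nonneg _)
  · exact Measurable.aestronglyMeasurable (by fun_prop)
  · filter_upwards [hpos] with ω hω t ht
    rw [Real.norm_eq_abs, abs_mul, mul_div_assoc]
    exact mul_le_mul_of_nonneg_left (abs_rpow_mul_log_le hω hδ (by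
      rwa [Metric.mem_ball, Real.dist_eq] at ht)) (abs_nonneg _)
  · filter_upwards [hpos] with ω hω t _
    have h0 : HasDerivAt (fun t : ℝ => t - 1) 1 t := (hasDerivAt_id t).sub_const 1
    have := (h0.const_rpow hω).const_mul (H ω)
    refine this.congr_deriv ?_
    ring

/-- The Schur product times the Gamma weights with parameters `z`. -/
def schurWeight {n : ℕ} (z x : Fin n → ℝ) : ℝ :=
  schurProd x * ∏ i, (Real.exp (-(x i)) * x i ^ (z i - 1))

lemma integrable_schurWeight {n : ℕ} {z : Fin n → ℝ} (hz : ∀ i, 0 < z i) :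
    Integrable (schurWeight z) (Measure.pi fun _ : Fin n => posVol) := by
  refine (Integrable.fintype_prod (μ := fun _ : Fin n => posVol)
    fun i => integrable_gammaWeight (hz i)).bdd_mul (c := 1)
    (Measurable.aestronglyMeasurable (by fun_prop)) ?_
  filter_upwards [ae_pos_pi n] with x hx using abs_schurProd_le_one hx

lemma integral_schurWeight {n : ℕ} {z : Fin n → ℝ} (hz : ∀ i, 0 < z i)
    (hinj : Function.Injective z) :
    ∫ x, schurWeight z x ∂Measure.pi (fun _ : Fin n => posVol)
      = schurProd z * ∏ i, Real.Gamma (z i) := by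
  refine (integral_schurProd_mul_prod z (fun i x => Real.exp (-x) * x ^ (z i - 1)) hz hinj
    (fun i => integrable_gammaWeight (hz i)) fun i j => ?_).trans ?_
  · rw [integral_gammaWeight (hz i), integral_gammaWeight (hz j)]
    exact integral_pair_gammaWeight (hz i) (hz j)
  · simp_rw [integral_gammaWeight (hz _)]

lemma hasDerivAt_Gamma {s : ℝ} (hs : 0 < s) :
    HasDerivAt Real.Gamma (Real.Gamma s * psi0 s) s := by
  have h : DifferentiableAt ℝ Real.Gamma s :=
    Real.differentiableAt_Gamma fun m => by
      have : (0 : ℝ) ≤ m := m.cast_nonneg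
      linarith
  refine h.hasDerivAt.congr_deriv ?_
  rw [psi0, mul_div_cancel₀ _ (Real.Gamma_pos_of_pos hs).ne']

lemma hasDerivAt_finset_prod_log {ι : Type*} (S : Finset ι) (f : ι → ℝ → ℝ) (g : ι → ℝ) (s : ℝ)
    (h : ∀ i ∈ S, HasDerivAt (f i) (f i s * g i) s) :
    HasDerivAt (fun t => ∏ i ∈ S, f i t) ((∏ i ∈ S, f i s) * ∑ i ∈ S, g i) s := by
  classical
  induction S using Finset.induction_on with
  | empty => simpa using hasDerivAt_const s (1 : ℝ)
  | insert i S hi ih =>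
    simp only [Finset.prod_insert hi, Finset.sum_insert hi]
    refine ((h i (Finset.mem_insert_self _ _)).mul
      (ih fun j hj => h j (Finset.mem_insert_of_mem hj))).congr_deriv ?_
    ring

lemma hasDerivAt_sub_div_add {s c : ℝ} (h1 : s - c ≠ 0) (h2 : s + c ≠ 0) :
    HasDerivAt (fun t => (t - c) / (t + c))
      ((s - c) / (s + c) * (1 / (s - c) - 1 / (s + c))) s := by
  refine (((hasDerivAt_id s).sub_const c).div ((hasDerivAt_id s).add_const c) h2).congr_deriv ?_
  simp only [id]
  field_simp

/-- The `k`-th factor of `schurProd z * ∏ Γ(z_i)`, as a function of the `k`-th parameter. -/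
def schurFactor {n : ℕ} (c : Fin n → ℝ) (s : ℝ) : ℝ :=
  Real.Gamma s * ∏ i, (s - c i) / (s + c i)

lemma hasDerivAt_schurFactor {n : ℕ} {c : Fin n → ℝ} {s : ℝ} (hs : 0 < s) (hc : ∀ i, 0 < c i)
    (hsc : ∀ i, s ≠ c i) :
    HasDerivAt (schurFactor c) (schurFactor c s
      * (psi0 s + ∑ i, (1 / (s - c i) - 1 / (s + c i)))) s := by
  refine ((hasDerivAt_Gamma hs).mul (hasDerivAt_finset_prod_log Finset.univ
    (fun i t => (t - c i) / (t + c i)) (fun i => 1 / (s - c i) - 1 / (s + c i)) s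
    fun i _ => hasDerivAt_sub_div_add (sub_ne_zero.2 (hsc i))
      (add_pos hs (hc i)).ne')).congr_deriv ?_
  simp only [schurFactor]
  ring

lemma schurProd_update_mul_prod_Gamma {n : ℕ} (z : Fin (n + 1) → ℝ) (k : Fin (n + 1)) (t : ℝ) :
    schurProd (Function.update z k t) * ∏ i, Real.Gamma (Function.update z k t i)
      = ((-1) ^ (k : ℕ) * schurProd (fun i => z (k.succAbove i))
          * ∏ i, Real.Gamma (z (k.succAbove i)))
        * schurFactor (fun i => z (k.succAbove i)) t := by
  rw [schurProd_succAbove _ k, Fin.prod_univ_succAbove _ k, schurFactor]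
  simp only [Function.update_self, Function.update_of_ne (Fin.succAbove_ne k _)]
  ring

lemma integral_schurWeight_mul_log {n : ℕ} {z : Fin (n + 1) → ℝ} (hz : ∀ i, 0 < z i)
    (hinj : Function.Injective z) (k : Fin (n + 1)) (hk : ∀ j, z k + 1 ≠ z j) :
    Integrable (fun x => schurWeight z x * (x k * Real.log (x k)))
        (Measure.pi fun _ : Fin (n + 1) => posVol) ∧
    ∫ x, schurWeight z x * (x k * Real.log (x k)) ∂Measure.pi (fun _ : Fin (n + 1) => posVol)
      = (schurProd z * ∏ i, Real.Gamma (z i))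
        * (schurFactor (fun i => z (k.succAbove i)) (z k + 1)
            / schurFactor (fun i => z (k.succAbove i)) (z k)
          * (psi0 (z k + 1) + ∑ i, (1 / (z k + 1 - z (k.succAbove i))
            - 1 / (z k + 1 + z (k.succAbove i))))) := by
  set μ := Measure.pi fun _ : Fin (n + 1) => posVol
  set c := fun i => z (k.succAbove i) with hc
  set H : (Fin (n + 1) → ℝ) → ℝ := fun x => schurProd x * (Real.exp (-(x k))
    * ∏ i, (Real.exp (-(x (k.succAbove i))) * x (k.succAbove i) ^ (c i - 1))) with hH
  have hup : ∀ (t : ℝ) x, H x * x k ^ (t - 1) = schurWeight (Function.update z k t) x := by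
    intro t x
    rw [schurWeight, Fin.prod_univ_succAbove _ k]
    simp only [Function.update_self, Function.update_of_ne (Fin.succAbove_ne k _), hH, hc]
    ring
  have hpos : ∀ t : ℝ, 0 < t → ∀ i, 0 < Function.update z k t i := by
    intro t ht i
    rcases eq_or_ne i k with rfl | h
    · simpa using ht
    · simpa [h] using hz i
  have hzk := hz k
  have hI : ∀ t : ℝ, 0 < t → Integrable (fun x => H x * x k ^ (t - 1)) μ := fun t ht => by
    simp only [hup]; exact integrable_schurWeight (hpos t ht)
  have hHm : Measurable H := by fun_prop
  obtain ⟨D1, D2⟩ := hasDerivAt_integral_rpow (μ := μ) (X := fun x => x k) (H := H)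
    (s := z k + 1) (δ := 1 / 4) (by fun_prop) hHm
    (by filter_upwards [ae_pos_pi (n + 1)] with x hx using hx k) (by norm_num)
    (by have := hI (z k + 1 + 1 / 2) (by linarith)
        ring_nf at this ⊢; exact this)
    (by have := hI (z k + 1 - 1 / 2) (by linarith)
        ring_nf at this ⊢; exact this)
  have hae : (fun x => H x * (x k ^ (z k + 1 - 1) * Real.log (x k)))
      =ᵐ[μ] fun x => schurWeight z x * (x k * Real.log (x k)) := by
    filter_upwards [ae_pos_pi (n + 1)] with x hx
    have := hup (z k) x
    rw [Function.update_eq_self] at this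
    rw [← this, show z k + 1 - 1 = z k - 1 + 1 by ring, Real.rpow_add_one (hx k).ne']
    ring
  refine ⟨D1.congr hae, ?_⟩
  rw [← integral_congr_ae hae]
  have hne : ∀ᶠ t in nhds (z k + 1), 0 < t ∧ ∀ i, t ≠ c i := by
    refine (eventually_gt_nhds (by linarith)).and (Filter.eventually_all.2 fun i => ?_)
    exact isOpen_ne.eventually_mem (hk _)
  have hev : (fun t => ∫ x, H x * x k ^ (t - 1) ∂μ) =ᶠ[nhds (z k + 1)]
      fun t => ((-1) ^ (k : ℕ) * schurProd c * ∏ i, Real.Gamma (c i)) * schurFactor c t := by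
    filter_upwards [hne] with t ht
    simp only [hup]
    rw [integral_schurWeight (hpos t ht.1), schurProd_update_mul_prod_Gamma]
    intro i j hij
    rcases Fin.eq_self_or_eq_succAbove k i with h' | ⟨i, rfl⟩ <;>
      rcases Fin.eq_self_or_eq_succAbove k j with h | ⟨j, rfl⟩
    · rw [h, h']
    · subst h'
      simp only [Function.update_self, Function.update_of_ne (Fin.succAbove_ne _ _)] at hij
      exact absurd hij (ht.2 j)
    · subst h
      simp only [Function.update_self, Function.update_of_ne (Fin.succAbove_ne _ _)] at hij
      exact absurd hij.symm (ht.2 i)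
    · simp only [Function.update_of_ne (Fin.succAbove_ne _ _)] at hij
      exact hinj hij
  have D3 := (hasDerivAt_schurFactor (c := c) (s := z k + 1) (by linarith) (fun i => hz _)
    fun i => hk _).const_mul ((-1) ^ (k : ℕ) * schurProd c * ∏ i, Real.Gamma (c i))
  have D4 := D2.unique (D3.congr_of_eventuallyEq hev)
  have e := schurProd_update_mul_prod_Gamma z k (z k)
  rw [Function.update_eq_self] at e
  have hf : schurFactor c (z k) ≠ 0 := by
    refine mul_ne_zero (Real.Gamma_pos_of_pos hzk).ne' (Finset.prod_ne_zero_iff.2 fun i _ => ?_)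
    exact div_ne_zero (sub_ne_zero.2 fun h => Fin.succAbove_ne k i (hinj h).symm)
      (add_pos hzk (hz _)).ne'
  rw [D4, e]
  change _ = ((-1) ^ (k : ℕ) * schurProd c * ∏ i, Real.Gamma (c i)) * schurFactor c (z k) * _
  field_simp
  rfl

lemma prod_filter_lt_eq {n : ℕ} (f : Fin n → Fin n → ℝ) :
    ∏ p ∈ Finset.univ.filter (fun p : Fin n × Fin n => p.1 < p.2), f p.1 p.2
      = ∏ i, ∏ j ∈ Finset.Ioi i, f i j := by
  rw [Finset.prod_filter, Fintype.prod_prod_type]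
  refine Finset.prod_congr rfl fun i _ => ?_
  rw [← Finset.prod_filter]
  congr 1
  ext j; simp

/-- The parameters `θk+a+1` of the Gamma weights. -/
def gammaParam (n : ℕ) (θ a : ℝ) (k : Fin n) : ℝ := θ * (k : ℕ) + a + 1

lemma gammaParam_pos {n : ℕ} {θ a : ℝ} (hθ : 0 < θ) (ha : -1 < a) (k : Fin n) :
    0 < gammaParam n θ a k := by
  have : 0 ≤ θ * ((k : ℕ) : ℝ) := by positivity
  unfold gammaParam
  linarith

lemma gammaParam_injective {n : ℕ} {θ a : ℝ} (hθ : 0 < θ) :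
    Function.Injective (gammaParam n θ a) := by
  intro i j h
  have h' : θ * ((i : ℕ) : ℝ) = θ * ((j : ℕ) : ℝ) := by
    unfold gammaParam at h; linarith
  exact Fin.ext (by exact_mod_cast mul_left_cancel₀ hθ.ne' h')

/-- The sign `(−1)^{n(n−1)/2}`. -/
def pairSign (n : ℕ) : ℝ := ∏ i : Fin n, ∏ _j ∈ Finset.Ioi i, (-1)

lemma pairSign_ne_zero (n : ℕ) : pairSign n ≠ 0 :=
  Finset.prod_ne_zero_iff.2 fun _ _ => Finset.prod_ne_zero_iff.2 fun _ _ => by norm_num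

lemma prod_sub_eq_pairSign_mul {n : ℕ} (v : Fin n → ℝ) :
    ∏ i, ∏ j ∈ Finset.Ioi i, (v i - v j) = pairSign n
      * ∑ σ : Equiv.Perm (Fin n), ((Equiv.Perm.sign σ : ℤ) : ℝ) * ∏ i, v (σ i) ^ (i : ℕ) := by
  have h : ∏ i, ∏ j ∈ Finset.Ioi i, (v i - v j)
      = pairSign n * ∏ i, ∏ j ∈ Finset.Ioi i, (v j - v i) := by
    simp only [pairSign, ← Finset.prod_mul_distrib, neg_one_mul, neg_sub]
  rw [h, ← Matrix.det_vandermonde, Matrix.det_apply']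
  rfl

lemma hWeight_eq_sum {n : ℕ} (θ a : ℝ) {x : Fin n → ℝ} (hx : ∀ i, 0 < x i) :
    hWeight n θ a x = pairSign n
      * ∑ σ : Equiv.Perm (Fin n), schurWeight (gammaParam n θ a) (fun i => x (σ i)) := by
  have hw : ∀ σ : Equiv.Perm (Fin n), ∏ i, x i ^ a * Real.exp (-(x i))
      = ∏ i, x (σ i) ^ a * Real.exp (-(x (σ i))) := fun σ =>
    (Equiv.prod_comp σ fun i => x i ^ a * Real.exp (-(x i))).symm
  unfold hWeight
  rw [Finset.prod_mul_distrib, prod_filter_lt_eq fun i j => (x i - x j) / (x i + x j),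
    prod_filter_lt_eq fun i j => x i ^ θ - x j ^ θ, prod_sub_eq_pairSign_mul fun i => x i ^ θ]
  change schurProd x * _ * _ = _
  rw [mul_left_comm, mul_assoc, Finset.mul_sum, Finset.sum_mul]
  congr 1
  refine Finset.sum_congr rfl fun σ _ => ?_
  rw [hw σ, schurWeight, schurProd_perm]
  rw [show ∏ i, (Real.exp (-(x (σ i))) * x (σ i) ^ (gammaParam n θ a i - 1))
    = (∏ i : Fin n, (x (σ i) ^ θ) ^ (i : ℕ)) * ∏ i, x (σ i) ^ a * Real.exp (-(x (σ i))) from ?_]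
  · ring
  · rw [← Finset.prod_mul_distrib]
    refine Finset.prod_congr rfl fun i _ => ?_
    rw [← Real.rpow_mul_natCast (hx _).le, ← mul_assoc, ← Real.rpow_add (hx _), mul_comm]
    congr 2
    unfold gammaParam
    ring

lemma measurePreserving_comp_perm {n : ℕ} (μ : Measure ℝ) [SigmaFinite μ]
    (σ : Equiv.Perm (Fin n)) :
    MeasurePreserving (MeasurableEquiv.piCongrLeft (fun _ : Fin n => ℝ) σ.symm)
      (Measure.pi fun _ => μ) (Measure.pi fun _ => μ) :=
  measurePreserving_piCongrLeft (fun _ : Fin n => μ) σ.symm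

lemma piCongrLeft_symm_apply {n : ℕ} (σ : Equiv.Perm (Fin n)) (x : Fin n → ℝ) :
    MeasurableEquiv.piCongrLeft (fun _ : Fin n => ℝ) σ.symm x = fun i => x (σ i) := by
  ext i
  have := MeasurableEquiv.piCongrLeft_apply_apply (β := fun _ : Fin n => ℝ) σ.symm x (σ i)
  simpa using this

lemma integrableOn_mul_hWeight {n : ℕ} (θ a : ℝ) {f : (Fin n → ℝ) → ℝ}
    (hf : ∀ (σ : Equiv.Perm (Fin n)) x, f (fun i => x (σ i)) = f x)
    (hi : Integrable (fun x => schurWeight (gammaParam n θ a) x * f x)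
      (Measure.pi fun _ : Fin n => posVol)) :
    IntegrableOn (fun x => f x * hWeight n θ a x) (orthant n) ∧
      ∫ x in orthant n, f x * hWeight n θ a x = pairSign n * n.factorial
        * ∫ x, schurWeight (gammaParam n θ a) x * f x ∂Measure.pi (fun _ : Fin n => posVol) := by
  set g : (Fin n → ℝ) → ℝ := fun x => schurWeight (gammaParam n θ a) x * f x
  have hae : (fun x => f x * hWeight n θ a x) =ᵐ[Measure.pi (fun _ : Fin n => posVol)]
      fun x => pairSign n * ∑ σ : Equiv.Perm (Fin n),
        g (MeasurableEquiv.piCongrLeft (fun _ : Fin n => ℝ) σ.symm x) := by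
    filter_upwards [ae_pos_pi n] with x hx
    rw [hWeight_eq_sum θ a hx, mul_left_comm, Finset.mul_sum]
    congr 1
    refine Finset.sum_congr rfl fun σ _ => ?_
    rw [piCongrLeft_symm_apply]
    simp only [g, hf, mul_comm]
  have hσ : ∀ σ : Equiv.Perm (Fin n),
      Integrable (fun x => g (MeasurableEquiv.piCongrLeft (fun _ : Fin n => ℝ) σ.symm x))
        (Measure.pi fun _ : Fin n => posVol) := fun σ =>
    (measurePreserving_comp_perm posVol σ).integrable_comp_of_integrable hi
  rw [IntegrableOn, restrict_orthant]
  refine ⟨((integrable_finsetSum _ fun σ _ => hσ σ).const_mul _).congr hae.symm, ?_⟩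
  rw [integral_congr_ae hae, integral_const_mul, integral_finsetSum _ fun σ _ => hσ σ]
  rw [Finset.sum_congr rfl fun σ _ => (measurePreserving_comp_perm posVol σ).integral_comp' g]
  rw [Finset.sum_const, Finset.card_univ, Fintype.card_perm, Fintype.card_fin, nsmul_eq_mul,
    mul_assoc]

lemma schurProd_ne_zero {n : ℕ} {z : Fin n → ℝ} (hz : ∀ i, 0 < z i)
    (hinj : Function.Injective z) : schurProd z ≠ 0 :=
  Finset.prod_ne_zero_iff.2 fun i _ => Finset.prod_ne_zero_iff.2 fun j hj =>
    div_ne_zero (sub_ne_zero.2 fun h => (Finset.mem_Ioi.1 hj).ne (hinj h))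
      (add_pos (hz i) (hz j)).ne'

lemma integral_hWeight (n : ℕ) {θ a : ℝ} (hθ : 0 < θ) (ha : -1 < a) :
    IntegrableOn (hWeight n θ a) (orthant n) ∧
      ∫ x in orthant n, hWeight n θ a x = pairSign n * n.factorial
        * (schurProd (gammaParam n θ a) * ∏ i, Real.Gamma (gammaParam n θ a i)) ∧
      ∫ x in orthant n, hWeight n θ a x ≠ 0 := by
  have hz := gammaParam_pos (n := n) hθ ha
  have hinj := gammaParam_injective (n := n) (a := a) hθ
  have h := integrableOn_mul_hWeight (n := n) θ a (f := fun _ => 1) (fun _ _ => rfl)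
    (by simpa using integrable_schurWeight hz)
  simp only [one_mul, mul_one] at h
  rw [integral_schurWeight hz hinj] at h
  refine ⟨h.1, h.2, ?_⟩
  rw [h.2]
  exact mul_ne_zero (mul_ne_zero (pairSign_ne_zero n) (Nat.cast_ne_zero.2 n.factorial_ne_zero))
    (mul_ne_zero (schurProd_ne_zero hz hinj)
      (Finset.prod_ne_zero_iff.2 fun i _ => (Real.Gamma_pos_of_pos (hz i)).ne'))

/-- The unconstrained average of `∑ x_i ln x_i`. -/
lemma integral_sum_mul_log_mul_hWeight (n : ℕ) {θ a : ℝ} (hθ : 0 < θ) (ha : -1 < a)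
    (hk : ∀ k j, gammaParam (n + 1) θ a k + 1 ≠ gammaParam (n + 1) θ a j) :
    IntegrableOn (fun x => (∑ i, x i * Real.log (x i)) * hWeight (n + 1) θ a x)
        (orthant (n + 1)) ∧
      ∫ x in orthant (n + 1), (∑ i, x i * Real.log (x i)) * hWeight (n + 1) θ a x
        = (∫ x in orthant (n + 1), hWeight (n + 1) θ a x)
          * ∑ k, schurFactor (fun i => gammaParam (n + 1) θ a (k.succAbove i))
              (gammaParam (n + 1) θ a k + 1)
            / schurFactor (fun i => gammaParam (n + 1) θ a (k.succAbove i))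
              (gammaParam (n + 1) θ a k)
            * (psi0 (gammaParam (n + 1) θ a k + 1) + ∑ i,
              (1 / (gammaParam (n + 1) θ a k + 1 - gammaParam (n + 1) θ a (k.succAbove i))
              - 1 / (gammaParam (n + 1) θ a k + 1
                + gammaParam (n + 1) θ a (k.succAbove i)))) := by
  have hz := gammaParam_pos (n := n + 1) hθ ha
  have hinj := gammaParam_injective (n := n + 1) (a := a) hθ
  have hD := fun k => integral_schurWeight_mul_log hz hinj k (hk k)
  have h := integrableOn_mul_hWeight (n := n + 1) θ a (f := fun x => ∑ i, x i * Real.log (x i))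
    (fun σ x => Equiv.sum_comp σ fun i => x i * Real.log (x i))
    (by simp only [Finset.mul_sum]; exact integrable_finsetSum _ fun k _ => (hD k).1)
  refine ⟨h.1, h.2.trans ?_⟩
  simp only [Finset.mul_sum]
  rw [integral_finsetSum _ fun k _ => (hD k).1, (integral_hWeight (n + 1) hθ ha).2.1,
    Finset.mul_sum]
  refine Finset.sum_congr rfl fun k _ => ?_
  rw [(hD k).2]
  ring

lemma integral_mul_log_gammaWeight {s : ℝ} (hs : 0 < s) :
    IntegrableOn (fun r => Real.exp (-r) * (r ^ (s - 1) * Real.log r)) (Set.Ioi 0) ∧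
      ∫ r in Set.Ioi (0 : ℝ), Real.exp (-r) * (r ^ (s - 1) * Real.log r)
        = Real.Gamma s * psi0 s := by
  have h := hasDerivAt_integral_rpow (μ := posVol) (X := fun r => r)
    (H := fun r => Real.exp (-r)) (s := s) (δ := s / 4) (by fun_prop) (by fun_prop)
    (by filter_upwards [ae_restrict_mem measurableSet_Ioi] with r hr using hr) (by linarith)
    (by have := integrable_gammaWeight (z := s + s / 2) (by linarith)
        ring_nf at this ⊢; exact this)
    (by have := integrable_gammaWeight (z := s - s / 2) (by linarith)
        ring_nf at this ⊢; exact this)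
  refine ⟨h.1, h.2.unique ((hasDerivAt_Gamma hs).congr_of_eventuallyEq ?_)⟩
  filter_upwards [eventually_gt_nhds hs] with t ht using integral_gammaWeight ht

lemma card_filter_lt (n : ℕ) :
    ((Finset.univ.filter fun p : Fin n × Fin n => p.1 < p.2).card : ℝ) = n * (n - 1) / 2 := by
  have h : (Finset.univ.filter fun p : Fin n × Fin n => p.1 < p.2).card = n.choose 2 := by
    have hj : ∀ j : Fin n, (∑ i : Fin n, if i < j then 1 else 0) = (j : ℕ) := fun j => by
      rw [← Finset.card_filter, ← Fin.card_Iio j]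
      congr 1
      ext i; simp
    rw [Finset.card_filter, Fintype.sum_prod_type, Finset.sum_comm, Finset.sum_congr rfl
      fun j _ => hj j, Fin.sum_univ_eq_sum_range (fun j => j), Finset.sum_range_id,
      Nat.choose_two_right]
  rw [h, Nat.cast_choose_two]

lemma dPar_pos {n : ℕ} {θ a : ℝ} (hθ : 0 < θ) (ha : -1 < a) : 0 < dPar (n + 1) θ a := by
  have : 0 ≤ (n : ℝ) * θ := by positivity
  unfold dPar
  push_cast
  have h2 : 0 < ((n : ℝ) + 1) * θ - θ + 2 * a + 2 := by nlinarith
  positivity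

lemma hWeight_smul {n : ℕ} (θ a : ℝ) {r : ℝ} (hr : 0 < r) {l : Fin n → ℝ} (hl : ∀ i, 0 ≤ l i) :
    hWeight n θ a (fun i => r * l i)
      = r ^ (dPar n θ a - n) * Real.exp (-(r * ∑ i, l i)) * Vdens n θ a l := by
  have h1 : ∀ p : Fin n × Fin n, (r * l p.1 - r * l p.2) / (r * l p.1 + r * l p.2)
      * ((r * l p.1) ^ θ - (r * l p.2) ^ θ)
      = r ^ θ * ((l p.1 - l p.2) / (l p.1 + l p.2) * (l p.1 ^ θ - l p.2 ^ θ)) := by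
    intro p
    rw [← mul_sub, ← mul_add, mul_div_mul_left _ _ hr.ne', Real.mul_rpow hr.le (hl _),
      Real.mul_rpow hr.le (hl _)]
    ring
  have h2 : ∀ i, (r * l i) ^ a * Real.exp (-(r * l i))
      = r ^ a * (l i ^ a * Real.exp (-(r * l i))) := fun i => by
    rw [Real.mul_rpow hr.le (hl i), mul_assoc]
  have h3 : r ^ (dPar n θ a - n)
      = (r ^ θ) ^ (Finset.univ.filter fun p : Fin n × Fin n => p.1 < p.2).card * (r ^ a) ^ n := by
    rw [← Real.rpow_mul_natCast hr.le, ← Real.rpow_mul_natCast hr.le, ← Real.rpow_add hr,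
      card_filter_lt]
    congr 1
    unfold dPar
    ring
  unfold hWeight Vdens
  simp only [h1, h2, Finset.prod_mul_distrib, Finset.prod_const, h3, Finset.card_univ,
    Fintype.card_fin]
  rw [← Real.exp_sum, Finset.sum_neg_distrib, ← Finset.mul_sum]
  ring

lemma measurable_simplexExt (m : ℕ) : Measurable (simplexExt m) := by
  refine measurable_pi_lambda _ fun i => ?_
  unfold simplexExt
  split_ifs <;> fun_prop

lemma abs_mul_log_le_one {x : ℝ} (h0 : 0 ≤ x) (h1 : x ≤ 1) : |x * Real.log x| ≤ 1 := by
  rcases h0.eq_or_lt with rfl | h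
  · simp
  · rw [mul_comm]
    exact (Real.abs_log_mul_self_lt x h h1).le

/-- Passing from the unconstrained to the constrained ensemble. -/
lemma Ef_entropy_eq (n : ℕ) {θ a S : ℝ} (hθ : 0 < θ) (ha : -1 < a)
    (hi : IntegrableOn (fun x => (∑ i, x i * Real.log (x i)) * hWeight (n + 1) θ a x)
        (orthant (n + 1)))
    (hS : ∫ x in orthant (n + 1), (∑ i, x i * Real.log (x i)) * hWeight (n + 1) θ a x
        = (∫ x in orthant (n + 1), hWeight (n + 1) θ a x) * S) :
    Ef (n + 1) θ a (fun lam => -∑ i, lam i * Real.log (lam i))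
      = psi0 (dPar (n + 1) θ a + 1) - S / dPar (n + 1) θ a := by
  obtain ⟨hI0, -, hne⟩ := integral_hWeight (n + 1) hθ ha
  have hd := dPar_pos (n := n) hθ ha
  set d := dPar (n + 1) θ a
  set D := simplexDom (n + 1)
  set B := ∫ l in D, Vdens (n + 1) θ a (simplexExt (n + 1) l) with hB
  set A := ∫ l in D, (∑ i, simplexExt (n + 1) l i * Real.log (simplexExt (n + 1) l i))
    * Vdens (n + 1) θ a (simplexExt (n + 1) l) with hA
  have hscale : ∀ r > 0, ∀ l ∈ D, hWeight (n + 1) θ a (fun i => r * simplexExt (n + 1) l i)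
      = r ^ (d - (n + 1 : ℕ)) * Real.exp (-r) * Vdens (n + 1) θ a (simplexExt (n + 1) l) := by
    intro r hr l hl
    rw [hWeight_smul θ a hr (simplexExt_nonneg hl), sum_simplexExt, mul_one]
  have e0 := integral_orthant_of_homogeneous n _ (Vdens (n + 1) θ a) _ hI0 hscale
  have hpow : ∀ r : ℝ, 0 < r → r ^ n * r ^ (d - (n + 1 : ℕ)) = r ^ (d - 1) := by
    intro r hr
    rw [← Real.rpow_natCast, ← Real.rpow_add hr]
    congr 1
    push_cast
    ring
  have g0 : ∫ r in Set.Ioi (0 : ℝ), r ^ n * (r ^ (d - (n + 1 : ℕ)) * Real.exp (-r))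
      = Real.Gamma d := by
    rw [Real.Gamma_eq_integral hd]
    refine setIntegral_congr_fun measurableSet_Ioi fun r hr => ?_
    rw [← mul_assoc, hpow r hr, mul_comm]
  rw [g0] at e0
  have hΓ := Real.Gamma_pos_of_pos hd
  have hB0 : B ≠ 0 := fun h => hne (by rw [e0, ← hB, h, mul_zero])
  have hVi : IntegrableOn (fun l => Vdens (n + 1) θ a (simplexExt (n + 1) l)) D := by
    by_contra h
    exact hB0 (integral_undef h)
  have hVLi : IntegrableOn (fun l =>
      (∑ i, simplexExt (n + 1) l i * Real.log (simplexExt (n + 1) l i))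
        * Vdens (n + 1) θ a (simplexExt (n + 1) l)) D := by
    have hm := measurable_simplexExt (n + 1)
    refine Integrable.bdd_mul (c := (n + 1 : ℕ)) hVi
      (Measurable.aestronglyMeasurable (by fun_prop)) ?_
    filter_upwards [ae_restrict_mem (measurableSet_simplexDom (n + 1))] with l hl
    refine (Finset.abs_sum_le_sum_abs _ _).trans ((Finset.sum_le_card_nsmul _ _ 1
      fun i _ => abs_mul_log_le_one (simplexExt_nonneg hl i) ?_).trans (by simp))
    rw [← sum_simplexExt n l]
    exact Finset.single_le_sum (f := fun i => simplexExt (n + 1) l i)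
      (fun j _ => simplexExt_nonneg hl j) (Finset.mem_univ i)
  have e1 : ∫ x in orthant (n + 1), (∑ i, x i * Real.log (x i)) * hWeight (n + 1) θ a x
      = ∫ r in Set.Ioi (0 : ℝ), (A * (Real.exp (-r) * r ^ (d + 1 - 1))
          + B * (Real.exp (-r) * (r ^ (d + 1 - 1) * Real.log r))) := by
    rw [integral_orthant_eq_integral_simplex n _ hi]
    refine setIntegral_congr_fun measurableSet_Ioi fun r hr => ?_
    have hr : 0 < r := hr
    have hin : ∀ l ∈ D, (∑ i, (r * simplexExt (n + 1) l i)
        * Real.log (r * simplexExt (n + 1) l i))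
        * hWeight (n + 1) θ a (fun i => r * simplexExt (n + 1) l i)
        = r ^ (d - (n + 1 : ℕ)) * Real.exp (-r) * r *
          ((∑ i, simplexExt (n + 1) l i * Real.log (simplexExt (n + 1) l i))
            * Vdens (n + 1) θ a (simplexExt (n + 1) l)
          + Real.log r * Vdens (n + 1) θ a (simplexExt (n + 1) l)) := by
      intro l hl
      rw [hscale r hr l hl]
      have : ∑ i, (r * simplexExt (n + 1) l i) * Real.log (r * simplexExt (n + 1) l i)
          = r * (∑ i, simplexExt (n + 1) l i * Real.log (simplexExt (n + 1) l i) + Real.log r) := by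
        have h1 : Real.log r = ∑ i, simplexExt (n + 1) l i * Real.log r := by
          rw [← Finset.sum_mul, sum_simplexExt, one_mul]
        conv_rhs => rw [h1]
        rw [← Finset.sum_add_distrib, Finset.mul_sum]
        refine Finset.sum_congr rfl fun i _ => ?_
        rcases (simplexExt_nonneg hl i).eq_or_lt with h | h
        · simp [← h]
        · rw [Real.log_mul hr.ne' h.ne']; ring
      rw [this]
      ring
    change r ^ n * (∫ l in D, _) = _
    rw [setIntegral_congr_fun (measurableSet_simplexDom _) hin, integral_const_mul,
      integral_add hVLi (hVi.const_mul _), integral_const_mul, ← hA, ← hB,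
      show d + 1 - 1 = d - 1 + 1 by ring, Real.rpow_add_one hr.ne', ← hpow r hr]
    ring
  have hd1 : 0 < d + 1 := by linarith
  obtain ⟨l1, l2⟩ := integral_mul_log_gammaWeight hd1
  rw [integral_add ((integrable_gammaWeight hd1).const_mul _) (l1.const_mul _),
    integral_const_mul, integral_const_mul, l2, integral_gammaWeight hd1, hS, e0,
    Real.Gamma_add_one hd.ne'] at e1
  have e2 : B * S = d * (A + B * psi0 (d + 1)) := by
    refine mul_left_cancel₀ hΓ.ne' ?_
    linear_combination e1
  have hEf : Ef (n + 1) θ a (fun lam => -∑ i, lam i * Real.log (lam i)) = -A / B := by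
    unfold Ef
    rw [hA, ← integral_neg]
    simp only [neg_mul]
    rfl
  rw [hEf]
  field_simp
  linear_combination e2

lemma ne_neg_natCast_add {x : ℝ} (hx : ∀ j : ℕ, x ≠ -(j : ℝ)) (i j : ℕ) : x + i ≠ -(j : ℝ) :=
  fun h => hx (i + j) (by push_cast; linarith)

lemma psi0_add_one {x : ℝ} (hx : ∀ j : ℕ, x ≠ -(j : ℝ)) : psi0 (x + 1) = psi0 x + 1 / x := by
  have hx0 : x ≠ 0 := by simpa using hx 0
  have hΓ := Real.Gamma_ne_zero hx
  have hx1 : ∀ j : ℕ, x + 1 ≠ -(j : ℝ) := by simpa using ne_neg_natCast_add hx 1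
  have h1 : HasDerivAt (fun t => Real.Gamma (t + 1)) (deriv Real.Gamma (x + 1)) x :=
    (Real.differentiableAt_Gamma hx1).hasDerivAt.comp_add_const x 1
  have h2 : HasDerivAt (fun t => t * Real.Gamma t)
      (1 * Real.Gamma x + x * deriv Real.Gamma x) x :=
    (hasDerivAt_id x).mul (Real.differentiableAt_Gamma hx).hasDerivAt
  have h3 := h1.unique (h2.congr_of_eventuallyEq (by
    filter_upwards [isOpen_ne.eventually_mem hx0] with t ht using Real.Gamma_add_one ht))
  unfold psi0
  rw [h3, Real.Gamma_add_one hx0]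
  field_simp
  ring

lemma Gamma_add_natCast {x : ℝ} (hx : ∀ j : ℕ, x ≠ -(j : ℝ)) (m : ℕ) :
    Real.Gamma (x + m) = Real.Gamma x * ∏ j ∈ Finset.range m, (x + j) := by
  induction m with
  | zero => simp
  | succ m ih =>
    rw [Finset.prod_range_succ, ← mul_assoc, ← ih, Nat.cast_succ, ← add_assoc,
      Real.Gamma_add_one (by simpa using ne_neg_natCast_add hx m 0), mul_comm]

lemma psi0_add_natCast {x : ℝ} (hx : ∀ j : ℕ, x ≠ -(j : ℝ)) (m : ℕ) :
    psi0 (x + m) = psi0 x + ∑ j ∈ Finset.range m, 1 / (x + j) := by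
  induction m with
  | zero => simp
  | succ m ih =>
    rw [Finset.sum_range_succ, ← add_assoc, ← ih, Nat.cast_succ, ← add_assoc,
      psi0_add_one (ne_neg_natCast_add hx m)]

lemma prod_add_natCast_eq {x : ℝ} (hx : ∀ j : ℕ, x ≠ -(j : ℝ)) (m : ℕ) :
    ∏ j ∈ Finset.range m, (x + j) = Real.Gamma (x + m) / Real.Gamma x := by
  rw [Gamma_add_natCast hx, mul_div_cancel_left₀ _ (Real.Gamma_ne_zero hx)]

lemma prod_erase_sub_eq (n : ℕ) (k : Fin (n + 1)) :
    ∏ i : Fin n, (((k : ℕ) : ℝ) - ((k.succAbove i : ℕ) : ℝ))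
      = (-1) ^ (n - (k : ℕ)) * (n - (k : ℕ)).factorial * (k : ℕ).factorial := by
  obtain ⟨r, hr⟩ := Nat.exists_eq_add_of_le (Nat.le_of_lt_succ k.2)
  set g : ℕ → ℝ := fun j => if j = k then 1 else ((k : ℕ) : ℝ) - j with hg
  have h1 : ∏ i : Fin n, (((k : ℕ) : ℝ) - ((k.succAbove i : ℕ) : ℝ))
      = ∏ j ∈ Finset.range (n + 1), g j := by
    rw [← Fin.prod_univ_eq_prod_range, Fin.prod_univ_succAbove _ k]
    simp only [hg, if_true, one_mul]
    refine Finset.prod_congr rfl fun i _ => ?_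
    rw [if_neg fun h => Fin.succAbove_ne k i (Fin.ext h)]
  have h2 : ∏ j ∈ Finset.range (k : ℕ), g j = (k : ℕ).factorial := by
    rw [← Finset.prod_range_reflect, ← Finset.prod_range_add_one_eq_factorial, Nat.cast_prod]
    refine Finset.prod_congr rfl fun j hj => ?_
    have hj := Finset.mem_range.1 hj
    simp only [hg]
    rw [if_neg (by omega), Nat.sub_sub, Nat.cast_sub (by omega)]
    push_cast
    ring
  have h3 : ∏ j ∈ Finset.range r, g (k + 1 + j) = (-1) ^ r * r.factorial := by
    have : ∀ j : ℕ, g (k + 1 + j) = -1 * ((j + 1 : ℕ) : ℝ) := fun j => by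
      simp only [hg]
      rw [if_neg (by omega)]
      push_cast
      ring
    simp only [this]
    rw [Finset.prod_mul_distrib, Finset.prod_const, Finset.card_range, ← Nat.cast_prod,
      Finset.prod_range_add_one_eq_factorial]
  have hn : n + 1 = k + 1 + r := by omega
  have h4 := Finset.prod_range_add g (k + 1) r
  rw [Finset.prod_range_succ, h2, h3, ← hn] at h4
  rw [h1, h4, show n - (k : ℕ) = r by omega]
  simp only [hg, if_true]
  ring

lemma summand_eq (n : ℕ) {θ a : ℝ} (hθ : 0 < θ) (ha : -1 < a) (k : Fin (n + 1))
    (hx : ∀ j : ℕ, ((k : ℕ) : ℝ) + 1 + 1 / θ - ((n + 1 : ℕ) : ℝ) ≠ -(j : ℝ)) :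
    schurFactor (fun i => gammaParam (n + 1) θ a (k.succAbove i))
              (gammaParam (n + 1) θ a k + 1)
            / schurFactor (fun i => gammaParam (n + 1) θ a (k.succAbove i))
              (gammaParam (n + 1) θ a k)
            * (psi0 (gammaParam (n + 1) θ a k + 1) + ∑ i,
              (1 / (gammaParam (n + 1) θ a k + 1 - gammaParam (n + 1) θ a (k.succAbove i))
              - 1 / (gammaParam (n + 1) θ a k + 1
                + gammaParam (n + 1) θ a (k.succAbove i))))
      = (-1 : ℝ) ^ ((k : ℕ) + (n + 1) - 1) * (θ * (k : ℕ) + a + 3 / 2)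
              * ((Real.Gamma ((k : ℕ) + (2 * a + 3) / θ)
                    * Real.Gamma ((k : ℕ) + (n + 1 : ℕ) + (2 * a + 2) / θ)
                    * Real.Gamma ((k : ℕ) + 1 + 1 / θ)
                  / (Real.Gamma ((k : ℕ) + (2 * a + 2) / θ)
                      * Real.Gamma ((k : ℕ) + (n + 1 : ℕ) + (2 * a + 3) / θ)
                      * Real.Gamma ((k : ℕ) + 1 + 1 / θ - (n + 1 : ℕ))))
                * (psi0 ((k : ℕ) + (2 * a + 3) / θ)
                    + psi0 ((k : ℕ) + 1 + 1 / θ)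
                    - psi0 ((k : ℕ) + (n + 1 : ℕ) + (2 * a + 3) / θ)
                    - psi0 ((k : ℕ) + 1 + 1 / θ - (n + 1 : ℕ))
                    + θ * (psi0 (θ * (k : ℕ) + a + 2)
                        - (θ * (k : ℕ) + a + 1) / (θ * (k : ℕ) + a + 3 / 2))))
              / ((Nat.factorial (n + 1 - 1 - k)) * (Nat.factorial k)) := by
  set z := gammaParam (n + 1) θ a with hz
  have hzpos : ∀ i, 0 < z i := gammaParam_pos hθ ha
  set c := fun i => z (k.succAbove i) with hc
  set κ : ℝ := ((k : ℕ) : ℝ) with hκ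
  have hκ0 : 0 ≤ κ := Nat.cast_nonneg _
  have hu : z k = θ * κ + a + 1 := rfl
  have hzj : ∀ j : Fin (n + 1), z j = θ * ((j : ℕ) : ℝ) + a + 1 := fun _ => rfl
  set x1 := κ + 1 + 1 / θ - ((n + 1 : ℕ) : ℝ) with hx1
  set x2 := κ + (2 * a + 3) / θ with hx2
  set x3 := κ + (2 * a + 2) / θ with hx3
  have hx2p : 0 < x2 := add_pos_of_nonneg_of_pos hκ0 (div_pos (by linarith) hθ)
  have hx3p : 0 < x3 := add_pos_of_nonneg_of_pos hκ0 (div_pos (by linarith) hθ)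
  have hpos_ne : ∀ x : ℝ, 0 < x → ∀ j : ℕ, x ≠ -(j : ℝ) := fun x hx j => by
    have : (0 : ℝ) ≤ j := j.cast_nonneg
    linarith
  have f1 : ∀ j ∈ Finset.range (n + 1), z k + 1 - (θ * (j : ℝ) + a + 1)
      = θ * (x1 + (((n + 1) - 1 - j : ℕ) : ℝ)) := by
    intro j hj
    have hj := Finset.mem_range.1 hj
    rw [Nat.sub_sub, Nat.cast_sub (by omega), hu, hx1]
    push_cast
    field_simp
    ring
  have f2 : ∀ j : ℕ, z k + 1 + (θ * (j : ℝ) + a + 1) = θ * (x2 + j) := by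
    intro j
    rw [hu, hx2]
    field_simp
    ring
  have f3 : ∀ j : ℕ, z k + (θ * (j : ℝ) + a + 1) = θ * (x3 + j) := by
    intro j
    rw [hu, hx3]
    field_simp
    ring
  have P1 : ∏ i, (z k + 1 - c i) = θ ^ (n + 1) * (Real.Gamma (x1 + (n + 1 : ℕ)) / Real.Gamma x1) := by
    have h := Fin.prod_univ_eq_prod_range (fun j : ℕ => z k + 1 - (θ * (j : ℝ) + a + 1)) (n + 1)
    rw [Fin.prod_univ_succAbove _ k, Finset.prod_congr rfl f1, Finset.prod_mul_distrib,
      Finset.prod_range_reflect (fun j : ℕ => x1 + (j : ℝ)), Finset.prod_const, Finset.card_range,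
      prod_add_natCast_eq hx] at h
    rw [← h]
    simp only [hc, hzj]
    ring
  have P2 : (2 * z k + 1) * ∏ i, (z k + 1 + c i)
      = θ ^ (n + 1) * (Real.Gamma (x2 + (n + 1 : ℕ)) / Real.Gamma x2) := by
    have h := Fin.prod_univ_eq_prod_range (fun j : ℕ => z k + 1 + (θ * (j : ℝ) + a + 1)) (n + 1)
    rw [Fin.prod_univ_succAbove _ k, Finset.prod_congr rfl fun j _ => f2 j,
      Finset.prod_mul_distrib, Finset.prod_const, Finset.card_range,
      prod_add_natCast_eq (hpos_ne _ hx2p)] at h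
    rw [← h]
    simp only [hc, hzj]
    ring
  have P3 : (2 * z k) * ∏ i, (z k + c i)
      = θ ^ (n + 1) * (Real.Gamma (x3 + (n + 1 : ℕ)) / Real.Gamma x3) := by
    have h := Fin.prod_univ_eq_prod_range (fun j : ℕ => z k + (θ * (j : ℝ) + a + 1)) (n + 1)
    rw [Fin.prod_univ_succAbove _ k, Finset.prod_congr rfl fun j _ => f3 j,
      Finset.prod_mul_distrib, Finset.prod_const, Finset.card_range,
      prod_add_natCast_eq (hpos_ne _ hx3p)] at h
    rw [← h]
    simp only [hc, hzj]
    ring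
  have P4 : ∏ i, (z k - c i)
      = θ ^ n * ((-1) ^ (n - (k : ℕ)) * (n - (k : ℕ)).factorial * (k : ℕ).factorial) := by
    have h : ∀ i, z k - c i = θ * (κ - ((k.succAbove i : ℕ) : ℝ)) := fun i => by
      simp only [hc, hzj]; ring
    simp only [h]
    rw [Finset.prod_mul_distrib, prod_erase_sub_eq]
    simp
  have S1c : ∑ j ∈ Finset.range (n + 1), 1 / (z k + 1 - (θ * (j : ℝ) + a + 1))
      = ∑ j ∈ Finset.range (n + 1), 1 / (θ * (x1 + ((n + 1 - 1 - j : ℕ) : ℝ))) :=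
    Finset.sum_congr rfl fun j hj => by rw [f1 j hj]
  have S2c : ∑ j ∈ Finset.range (n + 1), 1 / (z k + 1 + (θ * (j : ℝ) + a + 1))
      = ∑ j ∈ Finset.range (n + 1), 1 / (θ * (x2 + (j : ℝ))) :=
    Finset.sum_congr rfl fun j _ => by rw [f2 j]
  have S1 : θ * (1 + ∑ i, 1 / (z k + 1 - c i)) = psi0 (x1 + (n + 1 : ℕ)) - psi0 x1 := by
    have h := Fin.sum_univ_eq_sum_range (fun j : ℕ => 1 / (z k + 1 - (θ * (j : ℝ) + a + 1))) (n + 1)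
    rw [Fin.sum_univ_succAbove _ k, S1c,
      Finset.sum_range_reflect (fun j : ℕ => 1 / (θ * (x1 + (j : ℝ))))] at h
    rw [psi0_add_natCast hx]
    have h' : θ * ∑ j ∈ Finset.range (n + 1), 1 / (θ * (x1 + (j : ℝ)))
        = ∑ j ∈ Finset.range (n + 1), 1 / (x1 + (j : ℝ)) := by
      rw [Finset.mul_sum]
      refine Finset.sum_congr rfl fun j _ => ?_
      rw [one_div, one_div, mul_inv, mul_inv_cancel_left₀ hθ.ne']
    rw [add_sub_cancel_left, ← h', ← h]
    simp only [hc, hzj]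
    congr 2
    rw [← hκ, add_sub_cancel_left, div_one]
  have S2 : θ * (1 / (2 * z k + 1) + ∑ i, 1 / (z k + 1 + c i)) = psi0 (x2 + (n + 1 : ℕ)) - psi0 x2 := by
    have h := Fin.sum_univ_eq_sum_range (fun j : ℕ => 1 / (z k + 1 + (θ * (j : ℝ) + a + 1))) (n + 1)
    rw [Fin.sum_univ_succAbove _ k, S2c] at h
    rw [psi0_add_natCast (hpos_ne _ hx2p)]
    have h' : θ * ∑ j ∈ Finset.range (n + 1), 1 / (θ * (x2 + (j : ℝ)))
        = ∑ j ∈ Finset.range (n + 1), 1 / (x2 + (j : ℝ)) := by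
      rw [Finset.mul_sum]
      refine Finset.sum_congr rfl fun j _ => ?_
      rw [one_div, one_div, mul_inv, mul_inv_cancel_left₀ hθ.ne']
    rw [add_sub_cancel_left, ← h', ← h]
    simp only [hc, hzj]
    congr 3
    rw [← hκ]
    ring
  have hu0 := hzpos k
  have e1 : κ + 1 + 1 / θ = x1 + (n + 1 : ℕ) := by rw [hx1]; ring
  have e2 : κ + ((n + 1 : ℕ) : ℝ) + (2 * a + 3) / θ = x2 + (n + 1 : ℕ) := by rw [hx2]; ring
  have e3 : κ + ((n + 1 : ℕ) : ℝ) + (2 * a + 2) / θ = x3 + (n + 1 : ℕ) := by rw [hx3]; ring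
  have e4 : θ * κ + a + 2 = z k + 1 := by rw [hu]; ring
  have e5 : θ * κ + a + 3 / 2 = z k + 1 / 2 := by rw [hu]; ring
  rw [e1, e2, e3, e4, e5, ← hu, Finset.sum_sub_distrib]
  have hs : (-1 : ℝ) ^ ((k : ℕ) + (n + 1) - 1) * (-1) ^ (n - (k : ℕ)) = 1 := by
    have := k.2
    rw [← pow_add, show (k : ℕ) + (n + 1) - 1 + (n - k) = 2 * n by omega, pow_mul]
    norm_num
  set sg : ℝ := (-1) ^ (n - (k : ℕ)) with hsg
  have hsg0 : sg ≠ 0 := right_ne_zero_of_mul_eq_one hs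
  have hs' : (-1 : ℝ) ^ ((k : ℕ) + (n + 1) - 1) = 1 / sg := eq_div_of_mul_eq hsg0 hs
  have hbr : psi0 x2 + psi0 (x1 + (n + 1 : ℕ)) - psi0 (x2 + (n + 1 : ℕ)) - psi0 x1
      + θ * (psi0 (z k + 1) - z k / (z k + 1 / 2))
      = θ * (psi0 (z k + 1) + (∑ i, 1 / (z k + 1 - c i) - ∑ i, 1 / (z k + 1 + c i))) := by
    have : 1 - 1 / (2 * z k + 1) = z k / (z k + 1 / 2) := by
      field_simp
      ring
    linear_combination θ * this - S1 + S2
  rw [hbr, hs', show n + 1 - 1 - (k : ℕ) = n - k from rfl]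
  have hF : ((n - (k : ℕ)).factorial : ℝ) ≠ 0 := Nat.cast_ne_zero.2 (Nat.factorial_ne_zero _)
  have hK : (((k : ℕ)).factorial : ℝ) ≠ 0 := Nat.cast_ne_zero.2 (Nat.factorial_ne_zero _)
  have hG1 := Real.Gamma_ne_zero hx
  have hG2 := (Real.Gamma_pos_of_pos hx2p).ne'
  have hG3 := (Real.Gamma_pos_of_pos hx3p).ne'
  have hG4 : Real.Gamma (x2 + (n + 1 : ℕ)) ≠ 0 :=
    (Real.Gamma_pos_of_pos (add_pos_of_pos_of_nonneg hx2p (Nat.cast_nonneg _))).ne'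
  have hG5 : Real.Gamma (x3 + (n + 1 : ℕ)) ≠ 0 :=
    (Real.Gamma_pos_of_pos (add_pos_of_pos_of_nonneg hx3p (Nat.cast_nonneg _))).ne'
  have hGu := (Real.Gamma_pos_of_pos hu0).ne'
  have p2 : ∏ i, (z k + 1 + c i) = θ ^ (n + 1)
      * (Real.Gamma (x2 + (n + 1 : ℕ)) / Real.Gamma x2) / (2 * z k + 1) := by
    rw [← P2]; field_simp
  have p3 : ∏ i, (z k + c i) = θ ^ (n + 1)
      * (Real.Gamma (x3 + (n + 1 : ℕ)) / Real.Gamma x3) / (2 * z k) := by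
    rw [← P3]; field_simp
  simp only [schurFactor, Finset.prod_div_distrib]
  rw [Real.Gamma_add_one hu0.ne', P1, P4, p2, p3]
  generalize psi0 (z k + 1) + (∑ i, 1 / (z k + 1 - c i) - ∑ i, 1 / (z k + 1 + c i)) = E
  field_simp
  ring

/-- **Proposition 2: mean von Neumann entropy of the quantum interpolating
ensemble.** For `m ≥ 1`, `θ > 0`, `a > −1` such that `k + 1 + 1/θ − m` is not
a nonpositive integer for any `k ∈ {0,…,m−1}`, with `d = m(mθ−θ+2a+2)/2`:
`E_f[−Σ λ_i ln λ_i] = ψ₀(d+1) − Σ_{k=0}^{m−1} (−1)^{k+m−1} (θk+a+3/2) B_θ(k)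
                        / (d (m−1−k)! k!)`,
where `B_θ(k)` is the stated product of Gamma ratios and digamma values. -/
theorem mean_vonNeumann_interpolating (m : ℕ) (hm : 1 ≤ m) (θ a : ℝ)
    (hθ : 0 < θ) (ha : -1 < a)
    (hnd : ∀ k : ℕ, k < m → ∀ j : ℕ, (k : ℝ) + 1 + 1 / θ - m ≠ -(j : ℝ)) :
    Ef m θ a (fun lam => -∑ i, lam i * Real.log (lam i))
      = psi0 (dPar m θ a + 1)
        - ∑ k ∈ Finset.range m,
            (-1 : ℝ) ^ (k + m - 1) * (θ * k + a + 3 / 2)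
              * ((Real.Gamma ((k : ℝ) + (2 * a + 3) / θ)
                    * Real.Gamma ((k : ℝ) + m + (2 * a + 2) / θ)
                    * Real.Gamma ((k : ℝ) + 1 + 1 / θ)
                  / (Real.Gamma ((k : ℝ) + (2 * a + 2) / θ)
                      * Real.Gamma ((k : ℝ) + m + (2 * a + 3) / θ)
                      * Real.Gamma ((k : ℝ) + 1 + 1 / θ - m)))
                * (psi0 ((k : ℝ) + (2 * a + 3) / θ)
                    + psi0 ((k : ℝ) + 1 + 1 / θ)
                    - psi0 ((k : ℝ) + m + (2 * a + 3) / θ)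
                    - psi0 ((k : ℝ) + 1 + 1 / θ - m)
                    + θ * (psi0 (θ * k + a + 2)
                        - (θ * k + a + 1) / (θ * k + a + 3 / 2))))
              / (dPar m θ a * (Nat.factorial (m - 1 - k)) * (Nat.factorial k)) := by
  obtain ⟨n, rfl⟩ : ∃ n, m = n + 1 := ⟨m - 1, by omega⟩
  have hk : ∀ k j, gammaParam (n + 1) θ a k + 1 ≠ gammaParam (n + 1) θ a j := by
    intro k j h
    refine hnd k k.2 (n - j) ?_
    rw [Nat.cast_sub (Nat.le_of_lt_succ j.2)]
    have h' : θ * ((k : ℕ) : ℝ) + 1 = θ * ((j : ℕ) : ℝ) := by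
      unfold gammaParam at h
      linarith
    have : ((k : ℕ) : ℝ) + 1 / θ = (j : ℕ) := by
      field_simp
      linear_combination h'
    push_cast
    linear_combination this
  obtain ⟨hi, hS⟩ := integral_sum_mul_log_mul_hWeight n hθ ha hk
  rw [Ef_entropy_eq n hθ ha hi hS, ← Fin.sum_univ_eq_sum_range (n := n + 1), Finset.sum_div]
  congr 1
  refine Finset.sum_congr rfl fun k _ => ?_
  rw [summand_eq n hθ ha k (hnd k k.2), div_div]
  congr 1
  ring

end
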